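/- arXiv:1608.04588 — 2 statements merged into one kernel-verified Lean document; each statement's English description precedes it below -/
import Mathlib

section
/- Let R be a Gorenstein local ring and let a be a Gorenstein ideal of R with n = dim_R(R/a). Then β̂_i^R(R/a) = μ̂^{n+i}_R(R/a) for all i ∈ ℤ. In particular the ordinary Betti and Bass numbers satisfy β_i^R(R/a) = μ^{n+i}_R(R/a) for all i > G-dim_R(R/a). -/
open CategoryTheory CategoryTheory.Limits CategoryTheory.MonoidalCategory Opposite

noncomputable section

universe u

variable (R : Type u) [CommRing R]

/-- Ordinary `Ext` of `R`-modules, via the derived functor `Ext` of Mathlib. -/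
abbrev ExtMod (n : ℕ) (M N : ModuleCat.{u} R) : ModuleCat.{u} R :=
  ((Ext R (ModuleCat.{u} R) n).obj (op M)).obj N

/-- Ordinary `Tor` of `R`-modules, via the derived functor `Tor` of Mathlib. -/
abbrev TorMod (n : ℕ) (M N : ModuleCat.{u} R) : ModuleCat.{u} R :=
  ((Tor (ModuleCat.{u} R) n).obj M).obj N

/-- A finitely generated module `M` is totally reflexive (of G-dimension zero) if the
biduality map is an isomorphism and `Ext^i(M,R) = 0 = Ext^i(M^*,R)` for all `i > 0`. -/
def IsTotallyReflexive (M : ModuleCat.{u} R) : Prop :=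
  Module.Finite R M ∧
  Function.Bijective (Module.Dual.eval R M) ∧
  (∀ i : ℕ, 0 < i → IsZero (ExtMod R i M (ModuleCat.of R R))) ∧
  (∀ i : ℕ, 0 < i → IsZero (ExtMod R i (ModuleCat.of R (Module.Dual R M)) (ModuleCat.of R R)))

/-- `M` admits a resolution `0 → G_n → ⋯ → G_0 → M → 0` by totally reflexive modules. -/
def GDimLE (M : ModuleCat.{u} R) (n : ℕ) : Prop :=
  ∃ (G : ChainComplex (ModuleCat.{u} R) ℕ) (ε : G.X 0 ⟶ M),
    (∀ i, i ≤ n → IsTotallyReflexive R (G.X i)) ∧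
    (∀ i, n < i → IsZero (G.X i)) ∧
    Epi ε ∧
    (∃ w : G.d 1 0 ≫ ε = 0, (ShortComplex.mk (G.d 1 0) ε w).Exact) ∧
    (∀ i, 0 < i → G.ExactAt i)

/-- `M` has finite Gorenstein dimension. -/
def HasFiniteGDim (M : ModuleCat.{u} R) : Prop := ∃ n, GDimLE R M n

/-- The Gorenstein dimension of `M`, as an element of `ℕ∞`. -/
def gdim (M : ModuleCat.{u} R) : ℕ∞ :=
  sInf {c : ℕ∞ | ∃ n : ℕ, c = n ∧ GDimLE R M n}

/-- `M` admits a projective resolution of length at most `n`. -/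
def PdLE (M : ModuleCat.{u} R) (n : ℕ) : Prop :=
  ∃ (G : ChainComplex (ModuleCat.{u} R) ℕ) (ε : G.X 0 ⟶ M),
    (∀ i, Projective (G.X i)) ∧
    (∀ i, n < i → IsZero (G.X i)) ∧
    Epi ε ∧
    (∃ w : G.d 1 0 ≫ ε = 0, (ShortComplex.mk (G.d 1 0) ε w).Exact) ∧
    (∀ i, 0 < i → G.ExactAt i)

/-- `M` has finite projective dimension. -/
def HasFinitePd (M : ModuleCat.{u} R) : Prop := ∃ n, PdLE R M n

/-- The projective dimension of `M`, as an element of `ℕ∞`. -/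
def pdim (M : ModuleCat.{u} R) : ℕ∞ :=
  sInf {c : ℕ∞ | ∃ n : ℕ, c = n ∧ PdLE R M n}

/-- `M` admits an injective resolution `0 → M → I^0 → ⋯ → I^n → 0`. -/
def InjDimLE (M : ModuleCat.{u} R) (n : ℕ) : Prop :=
  ∃ (I : CochainComplex (ModuleCat.{u} R) ℕ) (ι : M ⟶ I.X 0),
    (∀ i, Injective (I.X i)) ∧
    (∀ i, n < i → IsZero (I.X i)) ∧
    Mono ι ∧
    (∃ w : ι ≫ I.d 0 1 = 0, (ShortComplex.mk ι (I.d 0 1) w).Exact) ∧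
    (∀ i, 0 < i → I.ExactAt i)

/-- `M` has finite injective dimension. -/
def HasFiniteInjDim (M : ModuleCat.{u} R) : Prop := ∃ n, InjDimLE R M n

/-- A Gorenstein local ring: a commutative Noetherian local ring of finite self-injective
dimension. -/
def IsGorensteinLocalRing : Prop :=
  IsLocalRing R ∧ IsNoetherianRing R ∧ HasFiniteInjDim R (ModuleCat.of R R)

/-- The grade of a module: `grade M = inf { i | Ext^i(M,R) ≠ 0 }`. -/
def gradeM (M : ModuleCat.{u} R) : ℕ∞ :=
  sInf {c : ℕ∞ | ∃ i : ℕ, c = i ∧ ¬ IsZero (ExtMod R i M (ModuleCat.of R R))}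

/-- A module is G-perfect if its grade equals its Gorenstein dimension. -/
def IsGPerfect (M : ModuleCat.{u} R) : Prop := gradeM R M = gdim R M

/-- An ideal `c` is perfect if `grade (R/c) = pd (R/c)`. -/
def IsPerfectIdeal (c : Ideal R) : Prop :=
  gradeM R (ModuleCat.of R (R ⧸ c)) = pdim R (ModuleCat.of R (R ⧸ c))

/-- A complete resolution `T → P → M` of `M`: `P → M` is a resolution by finite projective
modules, `T` is a totally acyclic complex of finite projective modules, and `θ i` is an
isomorphism for all `i ≫ 0`. -/
structure CompleteResolution (M : ModuleCat.{u} R) where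
  T : ChainComplex (ModuleCat.{u} R) ℤ
  P : ChainComplex (ModuleCat.{u} R) ℤ
  θ : T ⟶ P
  π : P.X 0 ⟶ M
  projT : ∀ i, Projective (T.X i)
  fgT : ∀ i, Module.Finite R (T.X i)
  projP : ∀ i, Projective (P.X i)
  fgP : ∀ i, Module.Finite R (P.X i)
  zeroP : ∀ i : ℤ, i < 0 → IsZero (P.X i)
  epiπ : Epi π
  wπ : P.d 1 0 ≫ π = 0
  exact0 : (ShortComplex.mk (P.d 1 0) π wπ).Exact
  exactP : ∀ i : ℤ, 0 < i → P.ExactAt i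
  exactT : ∀ i : ℤ, T.ExactAt i
  exactTdual : ∀ i : ℤ, (T.linearYonedaObj R (ModuleCat.of R R)).ExactAt i
  iso_eventually : ∃ n₀ : ℤ, ∀ i : ℤ, n₀ ≤ i → IsIso (θ.f i)

/-- Tate cohomology `Êxt^i(M,N) = H^i(Hom(T,N))` computed from a complete resolution of `M`. -/
def TateExt {M : ModuleCat.{u} R} (C : CompleteResolution R M) (N : ModuleCat.{u} R)
    (i : ℤ) : ModuleCat.{u} R :=
  (C.T.linearYonedaObj R N).homology i

/-- Tate homology `T̂or_i(M,N) = H_i(T ⊗ N)` computed from a complete resolution of `M`. -/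
def TateTor {M : ModuleCat.{u} R} (C : CompleteResolution R M) (N : ModuleCat.{u} R)
    (i : ℤ) : ModuleCat.{u} R :=
  ((((tensoringRight (ModuleCat.{u} R)).obj N).mapHomologicalComplex _).obj C.T).homology i

/-- The depth of a module over a local ring: the supremum of the lengths of the
`M`-regular sequences contained in the maximal ideal. -/
def moduleDepth [IsLocalRing R] (M : Type u) [AddCommGroup M] [Module R M] : ℕ∞ :=
  sSup {c : ℕ∞ | ∃ rs : List R, c = rs.length ∧
    (∀ r ∈ rs, r ∈ IsLocalRing.maximalIdeal R) ∧ RingTheory.Sequence.IsRegular M rs}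

/-- `E` is an injective envelope of the residue field `k`: an injective module which is an
essential extension of `k`. -/
def IsInjectiveEnvelopeOfResidueField [IsLocalRing R] (E : Type u) [AddCommGroup E]
    [Module R E] : Prop :=
  Injective (ModuleCat.of R E) ∧
  ∃ ι : IsLocalRing.ResidueField R →ₗ[R] E,
    Function.Injective ι ∧
    ∀ N : Submodule R E, N ≠ ⊥ → N ⊓ LinearMap.range ι ≠ ⊥


/-- A minimal free resolution `⋯ → F_1 → F_0 → M → 0` of a finitely generated module over a
local ring, recorded by its Betti numbers `b n` and differentials with image inside
`m • F_n`. -/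
structure MinFreeRes [IsLocalRing R] (M : Type u) [AddCommGroup M] [Module R M] where
  b : ℕ → ℕ
  d : ∀ n : ℕ, ((Fin (b (n+1)) → R) →ₗ[R] (Fin (b n) → R))
  aug : (Fin (b 0) → R) →ₗ[R] M
  aug_surj : Function.Surjective aug
  exact_zero : LinearMap.ker aug = LinearMap.range (d 0)
  exact_succ : ∀ n, LinearMap.ker (d n) = LinearMap.range (d (n+1))
  minimal : ∀ n, LinearMap.range (d n) ≤ (IsLocalRing.maximalIdeal R) • ⊤

/-- The Betti numbers of `M` are eventually bounded by `γ · n^(c-1)`. -/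
def CxLE [IsLocalRing R] (M : Type u) [AddCommGroup M] [Module R M] (c : ℕ) : Prop :=
  ∃ (F : MinFreeRes R M) (γ : ℝ) (n₀ : ℕ),
    ∀ n : ℕ, n₀ ≤ n → (F.b n : ℝ) ≤ γ * (n : ℝ) ^ ((c : ℤ) - 1)

/-- The complexity of a module: the least `c` such that the Betti numbers are eventually
bounded by `γ · n^(c-1)` for some `γ`. -/
def complexity [IsLocalRing R] (M : Type u) [AddCommGroup M] [Module R M] : ℕ∞ :=
  sInf {e : ℕ∞ | ∃ c : ℕ, e = c ∧ CxLE R M c}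

/-- The pushout `K_η` of a map `f : Ω^{j+1} M → M` (representing a degree-`(j+1)`
homogeneous element `η` of `Ext^*(M,M)`) along the inclusion `Ω^{j+1} M ↪ F_j`: the
cokernel of `(f, -incl) : Ω^{j+1} M → M ⊕ F_j`. -/
abbrev PushoutMod [IsLocalRing R] {M : Type u} [AddCommGroup M] [Module R M]
    (F : MinFreeRes R M) (j : ℕ) (f : LinearMap.range (F.d j) →ₗ[R] M) : Type u :=
  (M × (Fin (F.b j) → R)) ⧸
    LinearMap.range (LinearMap.prod f (-(LinearMap.range (F.d j)).subtype))

/-- Auxiliary predicate: `M` has reducible complexity, with recursion depth `≤ c`. -/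
def RedCxAux [IsLocalRing R] :
    ℕ → ∀ (M : Type u) (_ : AddCommGroup M) (_ : Module R M), Prop
  | 0, M, g, m =>
      letI := g; letI := m
      HasFinitePd R (ModuleCat.of R M)
  | (c+1), M, g, m =>
      letI := g; letI := m
      HasFinitePd R (ModuleCat.of R M) ∨
      (complexity R M < ⊤ ∧ 0 < complexity R M ∧
        ∃ (j : ℕ) (F : MinFreeRes R M) (f : LinearMap.range (F.d j) →ₗ[R] M),
          complexity R (PushoutMod R F j f) < complexity R M ∧
          moduleDepth R (PushoutMod R F j f) = moduleDepth R M ∧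
          RedCxAux c (PushoutMod R F j f) inferInstance inferInstance)

/-- `M` has reducible complexity. -/
def HasReducibleComplexity [IsLocalRing R] (M : Type u) [AddCommGroup M] [Module R M] :
    Prop :=
  ∃ c : ℕ, RedCxAux R c M inferInstance inferInstance

/-- `L` is (isomorphic to) `λ N = Ω Tr N`, computed from a minimal free presentation of `N`
over the local ring `S`. -/
def IsLambdaOf (S : Type u) [CommRing S] [IsLocalRing S]
    (N L : Type u) [AddCommGroup N] [Module S N] [AddCommGroup L] [Module S L] : Prop :=
  ∃ (n₀ n₁ : ℕ) (g : (Fin n₀ → S) →ₗ[S] N) (f : (Fin n₁ → S) →ₗ[S] (Fin n₀ → S)),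
    Function.Surjective g ∧
    LinearMap.range f = LinearMap.ker g ∧
    LinearMap.ker g ≤ (IsLocalRing.maximalIdeal S) • ⊤ ∧
    LinearMap.ker f ≤ (IsLocalRing.maximalIdeal S) • ⊤ ∧
    Nonempty (L ≃ₗ[S] LinearMap.range f.dualMap)

/-- `M` and `N` are linked by the ideal `c`: both are annihilated by `c` (hence are
`R/c`-modules) and `M ≅ λ_{R/c} N`, `N ≅ λ_{R/c} M`. -/
def LinkedBy (c : Ideal R) (M N : Type u) [AddCommGroup M] [Module (R ⧸ c) M]
    [AddCommGroup N] [Module (R ⧸ c) N] [IsLocalRing (R ⧸ c)] : Prop :=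
  IsLambdaOf (R ⧸ c) N M ∧ IsLambdaOf (R ⧸ c) M N

namespace GorBetti


theorem sc_exact_of_comp_mono {C : Type*} [Category C] [Abelian C] {X Y Z W : C}
    (f : X ⟶ Y) (g : Y ⟶ Z) (i : Z ⟶ W) [Mono i] (w : f ≫ g = 0) (w' : f ≫ (g ≫ i) = 0)
    (h : (ShortComplex.mk f (g ≫ i) w').Exact) : (ShortComplex.mk f g w).Exact := by
  let φ : ShortComplex.mk f g w ⟶ ShortComplex.mk f (g ≫ i) w' :=
    { τ₁ := 𝟙 _, τ₂ := 𝟙 _, τ₃ := i }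
  have : Epi φ.τ₁ := by dsimp [φ]; infer_instance
  have : IsIso φ.τ₂ := by dsimp [φ]; infer_instance
  have : Mono φ.τ₃ := by dsimp [φ]; infer_instance
  exact (ShortComplex.exact_iff_of_epi_of_isIso_of_mono φ).2 h

theorem hasInjDim_of_injDimLE (S : Type) [CommRing S] (M : ModuleCat.{0} S) (n : ℕ)
    (h : InjDimLE S M n) : HasInjectiveDimensionLT M (n + 2) := by
  obtain ⟨I, ι, hI, hz, hmono, ⟨w, hex⟩, hE⟩ := h
  have epi (i : ℕ) : Epi (kernel.lift (I.d (i+1) (i+2)) (I.d i (i+1)) (by simp)) := by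
    have := hE (i+1) (by omega)
    rw [HomologicalComplex.exactAt_iff' I i (i+1) (i+2) (by simp) (by simp)] at this
    exact (ShortComplex.exact_iff_epi_kernel_lift _).1 this
  have key : ∀ k i : ℕ, i + k = n + 1 →
      HasInjectiveDimensionLT (kernel (I.d i (i+1))) k := by
    intro k
    induction k with
    | zero =>
      intro i hi
      apply IsZero.hasInjectiveDimensionLT_zero
      exact IsZero.of_mono (kernel.ι (I.d i (i+1))) (hz i (by omega))
    | succ k ih =>
      intro i hi
      have h1 := ih (i+1) (by omega)
      have w1 : kernel.ι (I.d i (i+1)) ≫ kernel.lift (I.d (i+1) (i+2)) (I.d i (i+1)) (by simp) = 0 := by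
        rw [← cancel_mono (kernel.ι _)]; simp
      have : (ShortComplex.mk _ _ w1).ShortExact :=
        { exact := by
            apply sc_exact_of_comp_mono _ _ (kernel.ι (I.d (i+1) (i+2))) w1 (by simp)
            simpa using ShortComplex.exact_kernel (I.d i (i+1))
          mono_f := by dsimp; infer_instance
          epi_g := epi i }
      have := hI i
      refine ShortComplex.ShortExact.hasInjectiveDimensionLT_X₁ ‹_› k h1 ?_
      dsimp
      exact hasInjectiveDimensionLT_of_ge (I.X i) 1 _ (by omega)
  have w1 : ι ≫ kernel.lift (I.d 1 2) (I.d 0 1) (by simp) = 0 := by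
    rw [← cancel_mono (kernel.ι _)]; simpa using w
  have : (ShortComplex.mk _ _ w1).ShortExact :=
    { exact := by
        apply sc_exact_of_comp_mono _ _ (kernel.ι (I.d (1) (2))) w1 (by simpa using w)
        simpa using hex
      mono_f := hmono
      epi_g := epi 0 }
  have := hI 0
  have h1 : HasInjectiveDimensionLT (kernel (I.d 1 2)) n := key n 1 (by omega)
  have := ShortComplex.ShortExact.hasInjectiveDimensionLT_X₁ ‹_› n h1
    (by dsimp; exact hasInjectiveDimensionLT_of_ge (I.X 0) 1 _ (by omega))
  exact hasInjectiveDimensionLT_of_ge M (n+1) _ (by omega)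

end GorBetti

namespace GorBetti


/-- injective dimension `< r` for unbundled modules. -/
abbrev IDLT (S : Type) [CommRing S] (N : Type) [AddCommGroup N] [Module S N] (r : ℕ) : Prop :=
  HasInjectiveDimensionLT (ModuleCat.of S N) r

section
variable {S : Type} [CommRing S] {A B C : Type} [AddCommGroup A] [Module S A]
  [AddCommGroup B] [Module S B] [AddCommGroup C] [Module S C]

theorem ses_of (f : A →ₗ[S] B) (g : B →ₗ[S] C) (hf : Function.Injective f)
    (hg : Function.Surjective g) (he : Function.Exact f g) :
    (ShortComplex.mk (ModuleCat.ofHom f) (ModuleCat.ofHom g)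
      (by ext x; exact he.apply_apply_eq_zero x)).ShortExact :=
  ModuleCat.shortComplex_shortExact _ he hf hg

theorem idlt_one_iff : IDLT S A 1 ↔ Module.Injective S A := by
  rw [IDLT, ← injective_iff_hasInjectiveDimensionLT_one]
  exact (Module.injective_iff_injective_object S A).symm

theorem idlt_X₃ (f : A →ₗ[S] B) (g : B →ₗ[S] C) (hf : Function.Injective f)
    (hg : Function.Surjective g) (he : Function.Exact f g) {r : ℕ}
    (h1 : IDLT S A (r+1)) (h2 : IDLT S B r) : IDLT S C r :=
  (ses_of f g hf hg he).hasInjectiveDimensionLT_X₃ r h2 h1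

theorem idlt_X₁ (f : A →ₗ[S] B) (g : B →ₗ[S] C) (hf : Function.Injective f)
    (hg : Function.Surjective g) (he : Function.Exact f g) {r : ℕ}
    (h1 : IDLT S C r) (h2 : IDLT S B (r+1)) : IDLT S A (r+1) :=
  (ses_of f g hf hg he).hasInjectiveDimensionLT_X₁ r h1 h2

theorem idlt_mono {r s : ℕ} (h : r ≤ s) (h1 : IDLT S A r) : IDLT S A s :=
  hasInjectiveDimensionLT_of_ge _ r s h

theorem idlt_congr (e : A ≃ₗ[S] B) {r : ℕ} (h : IDLT S A r) : IDLT S B r :=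
  hasInjectiveDimensionLT_of_iso e.toModuleIso r

variable (S A) in
theorem exists_inj : ∃ (J : Type) (_ : AddCommGroup J) (_ : Module S J) (f : A →ₗ[S] J),
    Module.Injective S J ∧ Function.Injective f := by
  obtain ⟨J, hJ, f, hf⟩ := (EnoughInjectives.presentation (ModuleCat.of S A)).some
  exact ⟨J, inferInstance, inferInstance, f.hom, Module.injective_module_of_injective_object S J,
    (ModuleCat.mono_iff_injective f).1 hf⟩

theorem idlt_coker_iff (f : A →ₗ[S] B) (hf : Function.Injective f) (hB : Module.Injective S B)
    {r : ℕ} : IDLT S (B ⧸ LinearMap.range f) (r+1) ↔ IDLT S A (r+2) :=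
  (ses_of f (LinearMap.range f).mkQ hf (Submodule.mkQ_surjective _)
    f.exact_map_mkQ_range).hasInjectiveDimensionLT_X₃_iff r
      (Module.injective_object_of_injective_module S B)

theorem exists_div (hA : Module.Injective S A) {x : S} (hx : x ∈ nonZeroDivisors S) (a : A) :
    ∃ b : A, x • b = a := by
  obtain ⟨h, hh⟩ := hA.out (LinearMap.mulLeft S x) (by
      intro p q hpq
      exact (mul_cancel_left_mem_nonZeroDivisors hx).1 hpq) (LinearMap.toSpanSingleton S A a)
  refine ⟨h 1, ?_⟩
  have := hh 1
  simp at this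
  rw [← this, ← map_smul]; simp

abbrev Tors (x : S) (A : Type) [AddCommGroup A] [Module S A] : Type := Submodule.torsionBy S A x

/-- induced map on torsion, linear over the quotient ring. -/
def torsMap (x : S) (f : A →ₗ[S] B) : Tors x A →ₗ[S ⧸ Ideal.span {x}] Tors x B where
  toFun a := ⟨f a.1, by
    have := a.2
    rw [Submodule.mem_torsionBy_iff] at this ⊢
    rw [← map_smul, this, map_zero]⟩
  map_add' a b := by ext; simp
  map_smul' s a := by
    obtain ⟨s, rfl⟩ := Ideal.Quotient.mk_surjective s
    ext
    exact map_smul f s a.1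

theorem tors_injective (x : S) (hA : Module.Injective S A) :
    Module.Injective (S ⧸ Ideal.span {x}) (Tors x A) := by
  apply Module.Baer.injective
  intro I g
  let I' := I.comap (Ideal.Quotient.mk (Ideal.span {x}))
  let g0 : I' →ₗ[S] A :=
    { toFun := fun s => (g ⟨Ideal.Quotient.mk _ s.1, s.2⟩).1
      map_add' := fun s t => by
        rw [← Submodule.coe_add, ← map_add]; rfl
      map_smul' := fun s t => by
        have : (⟨Ideal.Quotient.mk _ (s • t).1, (s • t).2⟩ : I) =
          (Ideal.Quotient.mk (Ideal.span {x}) s) • (⟨Ideal.Quotient.mk _ t.1, t.2⟩ : I) := by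
            ext; simp
        rw [this, map_smul]; rfl }
  obtain ⟨h, hh⟩ := Module.Baer.of_injective hA I' g0
  have hx : x • h 1 = 0 := by
    rw [← map_smul, smul_eq_mul, mul_one]
    have hx0 : Ideal.Quotient.mk (Ideal.span {x}) x = 0 :=
      Ideal.Quotient.eq_zero_iff_mem.2 (Ideal.mem_span_singleton_self x)
    have hxm : x ∈ I' := by
      change Ideal.Quotient.mk _ x ∈ I
      rw [hx0]; exact I.zero_mem
    rw [hh x hxm]
    change (g ⟨Ideal.Quotient.mk _ x, _⟩).1 = 0
    have : (⟨Ideal.Quotient.mk _ x, hxm⟩ : I) = 0 := by ext; exact hx0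
    rw [this, map_zero]; rfl
  refine ⟨LinearMap.toSpanSingleton _ _ ⟨h 1, hx⟩, ?_⟩
  intro s hs
  obtain ⟨s, rfl⟩ := Ideal.Quotient.mk_surjective s
  ext
  change s • h 1 = _
  rw [← map_smul, smul_eq_mul, mul_one]
  exact hh s hs

theorem torsMap_injective (x : S) (f : A →ₗ[S] B) (hf : Function.Injective f) :
    Function.Injective (torsMap x f) := by
  intro a b hab
  ext
  exact hf (congrArg Subtype.val hab)

theorem torsMap_exact (x : S) (f : A →ₗ[S] B) (g : B →ₗ[S] C) (hf : Function.Injective f)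
    (he : Function.Exact f g) : Function.Exact (torsMap x f) (torsMap x g) := by
  intro b
  constructor
  · intro hb
    obtain ⟨a, ha⟩ := (he b.1).1 (congrArg Subtype.val hb)
    refine ⟨⟨a, ?_⟩, Subtype.ext ha⟩
    rw [Submodule.mem_torsionBy_iff]
    apply hf
    rw [map_smul, ha, map_zero]
    exact b.2
  · rintro ⟨a, rfl⟩
    ext
    exact he.apply_apply_eq_zero a.1

theorem torsMap_surj (x : S) (f : A →ₗ[S] B) (g : B →ₗ[S] C)
    (hg : Function.Surjective g)
    (he : Function.Exact f g) (hA : ∀ a : A, ∃ b, x • b = a) :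
    Function.Surjective (torsMap x g) := by
  rintro ⟨c, hc⟩
  obtain ⟨b, rfl⟩ := hg c
  rw [Submodule.mem_torsionBy_iff, ← map_smul] at hc
  obtain ⟨a, ha⟩ := (he _).1 hc
  obtain ⟨a', rfl⟩ := hA a
  refine ⟨⟨b - f a', ?_⟩, ?_⟩
  · rw [Submodule.mem_torsionBy_iff, smul_sub, ← map_smul, ha, sub_self]
  · ext
    change g (b - f a') = g b
    rw [map_sub, he.apply_apply_eq_zero, sub_zero]

end

theorem tors_idlt {S : Type} [CommRing S] {x : S} (hx : x ∈ nonZeroDivisors S) (r : ℕ) :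
    ∀ (A : Type) [AddCommGroup A] [Module S A], (∀ a : A, ∃ b, x • b = a) → IDLT S A (r+1) →
      IDLT (S ⧸ Ideal.span {x}) (Tors x A) (r+1) := by
  induction r with
  | zero =>
    intro A _ _ hA h
    rw [zero_add, idlt_one_iff] at h ⊢
    exact tors_injective x h
  | succ r ih =>
    intro A _ _ hA h
    obtain ⟨J, _, _, f, hJ, hf⟩ := exists_inj S A
    have h' := (idlt_coker_iff f hf hJ (r := r)).2 h
    have hd : ∀ a : (J ⧸ LinearMap.range f), ∃ b, x • b = a := by
      intro a
      obtain ⟨a, rfl⟩ := Submodule.mkQ_surjective _ a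
      obtain ⟨b, rfl⟩ := exists_div hJ hx a
      exact ⟨Submodule.mkQ _ b, by simp⟩
    have h2 := ih _ hd h'
    have := idlt_X₁ (torsMap x f) (torsMap x (LinearMap.range f).mkQ) (torsMap_injective x f hf)
      (torsMap_surj x f _ (Submodule.mkQ_surjective _) f.exact_map_mkQ_range hA)
      (torsMap_exact x f _ hf f.exact_map_mkQ_range) h2
      (idlt_mono (by omega) (idlt_one_iff.2 (tors_injective x hJ)))
    exact this

/-- If `S` has finite injective dimension, then so does `S/x` for a nonzerodivisor `x`. -/
theorem quot_idlt {S : Type} [CommRing S] {x : S} (hx : x ∈ nonZeroDivisors S) (r : ℕ)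
    (h : IDLT S S r) : IDLT (S ⧸ Ideal.span {x}) (S ⧸ Ideal.span {x}) (r+1) := by
  replace h : IDLT S S (r+2) := idlt_mono (by omega) h
  obtain ⟨J, _, _, f, hJ, hf⟩ := exists_inj S S
  have h' := (idlt_coker_iff f hf hJ (r := r)).2 h
  have hd : ∀ a : (J ⧸ LinearMap.range f), ∃ b, x • b = a := by
    intro a
    obtain ⟨a, rfl⟩ := Submodule.mkQ_surjective _ a
    obtain ⟨b, rfl⟩ := exists_div hJ hx a
    exact ⟨Submodule.mkQ _ b, by simp⟩
  have h2 := tors_idlt hx r _ hd h'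
  set g := (LinearMap.range f).mkQ with hg
  obtain ⟨i0, hi0⟩ := exists_div hJ hx (f 1)
  have hfs (s : S) : f s = s • f 1 := by rw [← map_smul]; simp
  have hz0 : g i0 ∈ Submodule.torsionBy S (J ⧸ LinearMap.range f) x := by
    rw [Submodule.mem_torsionBy_iff, ← map_smul, hi0]
    exact f.exact_map_mkQ_range.apply_apply_eq_zero 1
  let z0 : Tors x (J ⧸ LinearMap.range f) := ⟨g i0, hz0⟩
  let T := S ⧸ Ideal.span {x}
  let N := LinearMap.range (torsMap x g)
  -- the map S/x → Z[x]/im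
  let φ : T →ₗ[T] (Tors x (J ⧸ LinearMap.range f) ⧸ N) :=
    LinearMap.toSpanSingleton T _ (N.mkQ z0)
  have hinj : Function.Injective φ := by
    rw [← LinearMap.ker_eq_bot, LinearMap.ker_eq_bot']
    intro s hs
    obtain ⟨s, rfl⟩ := Ideal.Quotient.mk_surjective s
    have h1 : N.mkQ (Ideal.Quotient.mk _ s • z0) = 0 := hs
    rw [Submodule.mkQ_apply, Submodule.Quotient.mk_eq_zero] at h1
    obtain ⟨j, hj⟩ := h1
    have h2 : g j.1 = s • g i0 := congrArg Subtype.val hj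
    rw [← map_smul, ← sub_eq_zero, ← map_sub, f.exact_map_mkQ_range] at h2
    obtain ⟨t, ht⟩ := h2
    have h3 : x • f t = - (s • f 1) := by
      rw [ht, smul_sub, show x • j.1 = 0 from j.2, smul_comm, hi0, zero_sub]
    have h4 : x • t = -s := by
      apply hf
      rw [map_smul, h3, map_neg, ← hfs]
    rw [Ideal.Quotient.eq_zero_iff_mem, Ideal.mem_span_singleton]
    exact ⟨-t, by rw [mul_neg, ← smul_eq_mul, h4, neg_neg]⟩
  have hsurj : Function.Surjective φ := by
    intro z
    obtain ⟨z, rfl⟩ := N.mkQ_surjective z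
    obtain ⟨j, hj⟩ := Submodule.mkQ_surjective _ z.1
    have hz : x • z.1 = 0 := z.2
    rw [← hj, ← map_smul, f.exact_map_mkQ_range] at hz
    obtain ⟨s, hs⟩ := hz
    refine ⟨Ideal.Quotient.mk _ s, ?_⟩
    change N.mkQ (Ideal.Quotient.mk _ s • z0) = _
    symm
    rw [← sub_eq_zero, ← map_sub, Submodule.mkQ_apply, Submodule.Quotient.mk_eq_zero]
    refine ⟨⟨j - s • i0, ?_⟩, ?_⟩
    · rw [Submodule.mem_torsionBy_iff, smul_sub, ← hs, smul_comm, hi0, hfs, sub_self]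
    · ext
      change g (j - s • i0) = z.1 - s • g i0
      rw [map_sub, map_smul, ← hj]
  have e := LinearEquiv.ofBijective φ ⟨hinj, hsurj⟩
  have hZ : IDLT T (Tors x (J ⧸ LinearMap.range f) ⧸ N) (r+1) := by
    have hinj : Function.Injective (torsMap x g) := by
      rw [← LinearMap.ker_eq_bot, LinearMap.ker_eq_bot']
      intro j hj
      have h2 : g j.1 = 0 := congrArg Subtype.val hj
      rw [f.exact_map_mkQ_range] at h2
      obtain ⟨t, ht⟩ := h2
      have hxj : x • j.1 = 0 := j.2
      rw [← ht, ← map_smul] at hxj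
      have : x * t = 0 := hf (by rw [map_zero]; exact hxj)
      have : t = 0 := (mul_left_mem_nonZeroDivisors_eq_zero_iff hx).1 this
      ext
      rw [← ht, this, map_zero]; rfl
    exact idlt_X₃ (torsMap x g) N.mkQ hinj N.mkQ_surjective (torsMap x g).exact_map_mkQ_range
      (idlt_mono (by omega) (idlt_one_iff.2 (tors_injective x hJ))) h2
  exact idlt_congr e.symm hZ

end GorBetti

namespace GorBetti


section
variable {S : Type} [CommRing S] {A B C D : Type} [AddCommGroup A] [Module S A]
  [AddCommGroup B] [Module S B] [AddCommGroup C] [Module S C] [AddCommGroup D] [Module S D]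

variable (S) in
/-- vanishing of `Ext^r(A,B)`. -/
abbrev EZ (A : Type) [AddCommGroup A] [Module S A] (B : Type) [AddCommGroup B] [Module S B]
    (r : ℕ) : Prop :=
  ∀ e : Abelian.Ext.{0} (ModuleCat.of S A) (ModuleCat.of S B) r, e = 0

theorem ez_of_idlt {r s : ℕ} (h : IDLT S B r) (hrs : r ≤ s) : EZ S A B s := fun e =>
  e.eq_zero_of_hasInjectiveDimensionLT r hrs

theorem ez_mid (f : A →ₗ[S] B) (g : B →ₗ[S] C) (hf : Function.Injective f)
    (hg : Function.Surjective g) (he : Function.Exact f g) {r : ℕ}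
    (h1 : EZ S A D r) (h2 : EZ S C D r) : EZ S B D r := by
  intro e
  obtain ⟨x, hx⟩ := Abelian.Ext.contravariant_sequence_exact₂ (ses_of f g hf hg he) _ e (h1 _)
  rw [← hx, h2 x, Abelian.Ext.comp_zero]

theorem ez_left (f : A →ₗ[S] B) (g : B →ₗ[S] C) (hf : Function.Injective f)
    (hg : Function.Surjective g) (he : Function.Exact f g) {r : ℕ}
    (h1 : EZ S B D r) (h2 : EZ S C D (r+1)) : EZ S A D r := by
  intro e
  obtain ⟨x, hx⟩ := Abelian.Ext.contravariant_sequence_exact₁ (ses_of f g hf hg he) _ e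
    (add_comm 1 r) (h2 _)
  rw [← hx, h1 x, Abelian.Ext.comp_zero]

theorem ez_congr (e : A ≃ₗ[S] B) {r : ℕ} (h : EZ S B D r) : EZ S A D r := by
  intro x
  rw [← Abelian.Ext.mk₀_id_comp x, ← e.toModuleIso.hom_inv_id, ← Abelian.Ext.mk₀_comp_mk₀_assoc,
    h ((Abelian.Ext.mk₀ e.toModuleIso.inv).comp x (zero_add r)), Abelian.Ext.comp_zero]

theorem ez_of_subsingleton [Subsingleton A] {r : ℕ} : EZ S A D r := by
  intro x
  rw [← Abelian.Ext.mk₀_id_comp x]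
  have : (𝟙 (ModuleCat.of S A)) = 0 := by
    ext a; exact Subsingleton.elim _ _
  rw [this]; simp

theorem finite_zero_of_surj [IsLocalRing S] [Module.Finite S A] {y : S}
    (hy : y ∈ IsLocalRing.maximalIdeal S) (h : ∀ a : A, ∃ b, y • b = a) (a : A) : a = 0 := by
  have := Submodule.eq_bot_of_le_smul_of_le_jacobson_bot (IsLocalRing.maximalIdeal S)
    (⊤ : Submodule S A) Module.Finite.fg_top (by
      intro a _
      obtain ⟨b, rfl⟩ := h a
      exact Submodule.smul_mem_smul hy trivial) (IsLocalRing.maximalIdeal_le_jacobson _)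
  have ha : a ∈ (⊤ : Submodule S A) := trivial
  rw [this] at ha
  exact (Submodule.mem_bot S).1 ha

theorem ez_of_regular [IsLocalRing S] [IsNoetherianRing S] [Module.Finite S A] [Module.Finite S D]
    {y : S} (hy : y ∈ IsLocalRing.maximalIdeal S) (hinj : ∀ a : A, y • a = 0 → a = 0) {r : ℕ}
    (h : ∀ (C : Type) [AddCommGroup C] [Module S C], EZ S C D (r+1)) : EZ S A D r := by
  intro e
  refine finite_zero_of_surj hy (fun e => ?_) e
  let f : A →ₗ[S] A := LinearMap.lsmul S A y
  have hf : Function.Injective f := by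
    rw [← LinearMap.ker_eq_bot, LinearMap.ker_eq_bot']
    exact hinj
  obtain ⟨x, hx⟩ := Abelian.Ext.contravariant_sequence_exact₁ (ses_of f (LinearMap.range f).mkQ hf
    (Submodule.mkQ_surjective _) f.exact_map_mkQ_range) _ e (add_comm 1 r) (h _ _)
  refine ⟨x, ?_⟩
  rw [← hx]
  have : ModuleCat.ofHom f = y • 𝟙 (ModuleCat.of S A) := by ext a; rfl
  dsimp only
  rw [this, Abelian.Ext.mk₀_smul, Abelian.Ext.smul_comp, Abelian.Ext.mk₀_id_comp]

end

theorem idlt_of_ez {S : Type} [CommRing S] (r : ℕ) : ∀ (A : Type) [AddCommGroup A] [Module S A],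
    (∀ I : Ideal S, EZ S (S ⧸ I) A (r+1)) → IDLT S A (r+1) := by
  induction r with
  | zero =>
    intro A _ _ h
    rw [zero_add, idlt_one_iff]
    apply Module.Baer.injective
    intro I g
    obtain ⟨φ, hφ⟩ := Abelian.Ext.contravariant_sequence_exact₁
      (ses_of (Submodule.subtype I) (Submodule.mkQ I) I.injective_subtype
        I.mkQ_surjective (LinearMap.exact_subtype_mkQ I)) _ (Abelian.Ext.mk₀ (ModuleCat.ofHom g))
        (add_comm 1 0) (h I _)
    obtain ⟨φ, rfl⟩ := Abelian.Ext.homEquiv₀.symm.surjective φ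
    refine ⟨φ.hom, fun x hx => ?_⟩
    have := Abelian.Ext.homEquiv₀.symm.injective (a₁ := ModuleCat.ofHom (Submodule.subtype I) ≫ φ)
      (a₂ := ModuleCat.ofHom g) (by simpa using hφ)
    exact congrArg (fun k => k.hom ⟨x, hx⟩) this
  | succ r ih =>
    intro A _ _ h
    obtain ⟨J, _, _, f, hJ, hf⟩ := exists_inj S A
    rw [show r + 1 + 1 = r + 2 from rfl, ← idlt_coker_iff f hf hJ]
    apply ih
    intro I e
    obtain ⟨x, hx⟩ := Abelian.Ext.covariant_sequence_exact₃ _ (ses_of f (LinearMap.range f).mkQ hf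
      (Submodule.mkQ_surjective _) f.exact_map_mkQ_range) e rfl (h I _)
    rw [← hx, ez_of_idlt (idlt_one_iff.2 hJ) (by omega) x, Abelian.Ext.zero_comp]

/-- A local noetherian ring of finite injective dimension with nonzero socle is self-injective. -/
theorem selfinj_of_socle {S : Type} [CommRing S] [IsLocalRing S] [IsNoetherianRing S] (s : S)
    (hs : s ≠ 0) (hm : ∀ y ∈ IsLocalRing.maximalIdeal S, y * s = 0) (r : ℕ)
    (h : IDLT S S (r+1)) : Module.Injective S S := by
  induction r with
  | zero => exact idlt_one_iff.1 h
  | succ r ih =>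
    apply ih
    apply idlt_of_ez
    intro I
    have hext : ∀ (C : Type) [AddCommGroup C] [Module S C], EZ S C S (r+1+1) :=
      fun C _ _ => ez_of_idlt h le_rfl
    have hSS : EZ S S S (r+1) := by
      intro e
      have : Projective (ModuleCat.of S S) := (IsProjective.iff_projective S).1 inferInstance
      exact e.eq_zero_of_projective
    refine IsNoetherianRing.induction_on_isQuotientEquivQuotientPrime S (M := S ⧸ I) inferInstance
      (motive := fun N _ _ _ => EZ S N S (r+1)) ?_ ?_ ?_
    · intro N _ _ _ _
      exact ez_of_subsingleton
    · intro N _ _ _ p e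
      refine ez_congr e ?_
      by_cases hp : p.1 = IsLocalRing.maximalIdeal S
      · let f : (S ⧸ p.1) →ₗ[S] S := Submodule.liftQ p.1 (LinearMap.toSpanSingleton S S s) (by
          intro y hy
          rw [hp] at hy
          exact hm y hy)
        have hf : Function.Injective f := by
          rw [← LinearMap.ker_eq_bot, LinearMap.ker_eq_bot']
          intro y hy
          obtain ⟨y, rfl⟩ := Submodule.mkQ_surjective _ y
          have hy : y * s = 0 := hy
          rw [Submodule.mkQ_apply, Submodule.Quotient.mk_eq_zero, hp]
          by_contra hcon
          rw [IsLocalRing.mem_maximalIdeal, mem_nonunits_iff, not_not] at hcon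
          exact hs (hcon.mul_right_eq_zero.1 hy)
        exact ez_left f (LinearMap.range f).mkQ hf (Submodule.mkQ_surjective _)
          f.exact_map_mkQ_range hSS (hext _)
      · obtain ⟨y, hy, hyp⟩ : ∃ y ∈ IsLocalRing.maximalIdeal S, y ∉ p.1 := by
          by_contra! hcon
          exact hp (le_antisymm (IsLocalRing.le_maximalIdeal p.2.ne_top) hcon)
        refine ez_of_regular hy ?_ hext
        intro a ha
        obtain ⟨a, rfl⟩ := Submodule.mkQ_surjective _ a
        rw [← map_smul, Submodule.mkQ_apply, Submodule.Quotient.mk_eq_zero] at ha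
        rw [Submodule.mkQ_apply, Submodule.Quotient.mk_eq_zero]
        exact (p.2.mem_or_mem ha).resolve_left hyp
    · intro N1 _ _ _ N2 _ _ _ N3 _ _ _ f g hf hg he h1 h3
      exact ez_mid f g hf hg he h1 h3

end GorBetti

namespace GorBetti


theorem dim_zero_of_selfinj {S : Type} [CommRing S] [IsLocalRing S] [IsNoetherianRing S]
    (h : Module.Injective S S) : ringKrullDim S = 0 := by
  rw [← ringKrullDimZero_iff_ringKrullDim_eq_zero,
    Ring.krullDimLE_zero_iff_forall_minimalPrimes_isMaximal]
  intro p hp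
  have hp1 : p.IsPrime := hp.1.1
  have hass : p ∈ associatedPrimes S S := by
    apply Module.associatedPrimes.minimalPrimes_annihilator_subset_associatedPrimes
    rwa [show Module.annihilator S S = ⊥ from Module.annihilator_eq_bot.2 inferInstance]
  suffices p = IsLocalRing.maximalIdeal S by rw [this]; infer_instance
  by_contra hne
  obtain ⟨y, hy, hyp⟩ : ∃ y ∈ IsLocalRing.maximalIdeal S, y ∉ p := by
    by_contra! hcon
    exact hne (le_antisymm (IsLocalRing.le_maximalIdeal hp1.ne_top) hcon)
  rw [AssociatedPrimes.mem_iff, isAssociatedPrime_iff] at hass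
  obtain ⟨-, s, hs⟩ := hass
  have hmem (t : S) : t ∈ p ↔ t * s = 0 := by
    rw [hs, Submodule.mem_colon_singleton]; rfl
  let f : (S ⧸ p) →ₗ[S] S := Submodule.liftQ p (LinearMap.toSpanSingleton S S s) (by
    intro t ht
    exact (hmem t).1 ht)
  have : f = 0 := by
    refine finite_zero_of_surj (S := S) hy (fun g => ?_) f
    obtain ⟨g', hg'⟩ := h.out (LinearMap.lsmul S (S ⧸ p) y) (by
        rw [← LinearMap.ker_eq_bot, LinearMap.ker_eq_bot']
        intro a ha
        obtain ⟨a, rfl⟩ := Submodule.mkQ_surjective _ a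
        rw [LinearMap.lsmul_apply, ← map_smul, Submodule.mkQ_apply,
          Submodule.Quotient.mk_eq_zero] at ha
        rw [Submodule.mkQ_apply, Submodule.Quotient.mk_eq_zero]
        exact (hp1.mem_or_mem ha).resolve_left hyp) g
    refine ⟨g', ?_⟩
    ext
    have := hg' (Submodule.mkQ p 1)
    simpa using this
  have h1 : f (Submodule.mkQ p 1) = s := one_mul s
  rw [this] at h1
  have : (1 : S) ∈ p := by rw [hmem, ← h1]; simp
  exact hp1.ne_top ((Ideal.eq_top_iff_one p).2 this)

/-- structure of local rings of finite self-injective dimension. -/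
theorem gor_cases {S : Type} [CommRing S] [IsLocalRing S] [IsNoetherianRing S] (n : ℕ)
    (hn : ringKrullDim S = n) (r : ℕ) (h : IDLT S S r) :
    (n = 0 ∧ Module.Injective S S) ∨ ∃ n' : ℕ, n = n' + 1 ∧
      ∃ x ∈ IsLocalRing.maximalIdeal S, x ∈ nonZeroDivisors S ∧
        ringKrullDim (S ⧸ Ideal.span {x}) = n' ∧
        IDLT (S ⧸ Ideal.span {x}) (S ⧸ Ideal.span {x}) (r + 1) := by
  by_cases hd : Disjoint (IsLocalRing.maximalIdeal S : Set S) (nonZeroDivisors S)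
  · left
    have := Ideal.bot_lt_annihilator_of_disjoint_nonZeroDivisors hd
    obtain ⟨s, hs, hs0⟩ := SetLike.exists_of_lt this
    have hinj : Module.Injective S S := selfinj_of_socle s (by simpa using hs0) (by
      intro y hy
      have := Module.mem_annihilator.1 hs ⟨y, hy⟩
      rw [mul_comm]
      exact congrArg Subtype.val this) r (idlt_mono (by omega) h)
    refine ⟨?_, hinj⟩
    have := dim_zero_of_selfinj hinj
    rw [hn] at this
    exact_mod_cast this
  · right
    rw [Set.not_disjoint_iff] at hd
    obtain ⟨x, hx, hx'⟩ := hd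
    have hdim := ringKrullDim_quotient_span_singleton_succ_eq_ringKrullDim_of_mem_nonZeroDivisors hx' hx
    have hnt : Nontrivial (S ⧸ Ideal.span {x}) := by
      apply Ideal.Quotient.nontrivial_iff.2
      intro htop
      have : Ideal.span {x} ≤ IsLocalRing.maximalIdeal S := by
        rw [Ideal.span_le]; simpa using hx
      rw [htop] at this
      exact (IsLocalRing.maximalIdeal.isMaximal S).ne_top (top_le_iff.1 this)
    have hge : 0 ≤ ringKrullDim (S ⧸ Ideal.span {x}) := ringKrullDim_nonneg_of_nontrivial
    rw [hn] at hdim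
    generalize hD : ringKrullDim (S ⧸ Ideal.span {x}) = D at hdim hge
    have : ∃ n' : ℕ, D = n' := by
      match D, hge, hdim with
      | ⊥, h, _ => simp at h
      | (m : ℕ∞), _, hd =>
        cases m with
        | top => 
          exfalso
          have h1 : ((⊤ + 1 : ℕ∞) : WithBot ℕ∞) = ((n : ℕ∞) : WithBot ℕ∞) := hd
          rw [WithBot.coe_inj, top_add] at h1
          exact ENat.natCast_ne_top n h1.symm
        | coe m => exact ⟨m, rfl⟩
    obtain ⟨n', rfl⟩ := this
    refine ⟨n', ?_, x, hx, hx', hD, quot_idlt hx' r h⟩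
    exact_mod_cast hdim.symm

end GorBetti

namespace GorBetti
open scoped TensorProduct


section
variable {R : Type} [CommRing R] {A B C A' B' C' : Type} [AddCommGroup A] [Module R A]
  [AddCommGroup B] [Module R B] [AddCommGroup C] [Module R C] [AddCommGroup A'] [Module R A']
  [AddCommGroup B'] [Module R B'] [AddCommGroup C'] [Module R C']

abbrev eT (e1 : A ≃ₗ[R] B) (e2 : B ≃ₗ[R] C) : A ≃ₗ[R] C := e1.trans e2

/-- concrete homology of `A → B → C` (no complex condition needed). -/
abbrev Hm (f : A →ₗ[R] B) (g : B →ₗ[R] C) : Type :=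
  LinearMap.ker g ⧸ (LinearMap.range f).submoduleOf (LinearMap.ker g)

def hmCongr (f : A →ₗ[R] B) (g : B →ₗ[R] C) (f' : A' →ₗ[R] B') (g' : B' →ₗ[R] C')
    (e : B ≃ₗ[R] B') (hk : ∀ b, g b = 0 ↔ g' (e b) = 0)
    (hr : ∀ b, b ∈ LinearMap.range f ↔ e b ∈ LinearMap.range f') : Hm f g ≃ₗ[R] Hm f' g' := by
  have h1 : Submodule.map e.toLinearMap (LinearMap.ker g) = LinearMap.ker g' := by
    ext b
    simp only [Submodule.mem_map, LinearMap.mem_ker]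
    constructor
    · rintro ⟨b, hb, rfl⟩; exact (hk b).1 hb
    · intro hb
      refine ⟨e.symm b, (hk _).2 (by simpa using hb), by simp⟩
  let e1 : LinearMap.ker g ≃ₗ[R] LinearMap.ker g' := e.ofSubmodules _ _ h1
  refine Submodule.Quotient.equiv _ _ e1 ?_
  ext b
  simp only [Submodule.mem_map, Submodule.submoduleOf, Submodule.mem_comap]
  constructor
  · rintro ⟨b, hb, rfl⟩
    exact (hr b.1).1 hb
  · intro hb
    refine ⟨e1.symm b, (hr _).2 ?_, by simp⟩
    have : e (e1.symm b).1 = b.1 := congrArg Subtype.val (e1.apply_symm_apply b)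
    change e (e1.symm b).1 ∈ _
    rw [this]; exact hb

theorem hm_kill {f : A →ₗ[R] B} {g : B →ₗ[R] C} {y : R}
    (h : ∀ b, g b = 0 → y • b ∈ LinearMap.range f) (z : Hm f g) : y • z = 0 := by
  obtain ⟨b, rfl⟩ := Submodule.mkQ_surjective _ z
  rw [← map_smul, Submodule.mkQ_apply, Submodule.Quotient.mk_eq_zero]
  exact h b.1 b.2

theorem hm_subsingleton {f : A →ₗ[R] B} {g : B →ₗ[R] C}
    (h : ∀ b, g b = 0 → b ∈ LinearMap.range f) : Subsingleton (Hm f g) := by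
  refine subsingleton_of_forall_eq 0 (fun z => ?_)
  have := hm_kill (y := (1:R)) (f := f) (g := g) (fun b hb => by simpa using h b hb) z
  simpa using this

end

section
variable {R : Type} [CommRing R]

def homologyEquiv {ι : Type} {c : ComplexShape ι} (K : HomologicalComplex (ModuleCat.{0} R) c)
    (i j k : ι) (hi : c.prev j = i) (hk : c.next j = k) :
    K.homology j ≃ₗ[R] Hm (K.d i j).hom (K.d j k).hom := by
  refine eT ((K.homologyIsoSc' i j k hi hk).toLinearEquiv)
    (eT ((K.sc' i j k).moduleCatHomologyIso.toLinearEquiv) ?_)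
  refine Submodule.quotEquivOfEq _ _ ?_
  ext b
  simp only [LinearMap.mem_range, Submodule.submoduleOf]
  constructor
  · rintro ⟨a, rfl⟩; exact ⟨a, rfl⟩
  · rintro ⟨a, ha⟩; exact ⟨a, Subtype.ext ha⟩

theorem exactAt_iff_hm {ι : Type} {c : ComplexShape ι} (K : HomologicalComplex (ModuleCat.{0} R) c)
    (i j k : ι) (hi : c.prev j = i) (hk : c.next j = k) :
    K.ExactAt j ↔ Function.Exact (K.d i j).hom (K.d j k).hom := by
  rw [K.exactAt_iff' i j k hi hk]
  exact ShortComplex.ShortExact.moduleCat_exact_iff_function_exact _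

abbrev CC (R : Type) [CommRing R] := ChainComplex (ModuleCat.{0} R) ℤ

/-- the tensor complex -/
abbrev TC (X : CC R) (N : ModuleCat.{0} R) : CC R :=
  (((tensoringRight (ModuleCat.{0} R)).obj N).mapHomologicalComplex _).obj X

abbrev HT (X : CC R) (N : Type) [AddCommGroup N] [Module R N] (q : ℤ) : ModuleCat R :=
  (TC X (ModuleCat.of R N)).homology q

abbrev HE (X : CC R) (N : Type) [AddCommGroup N] [Module R N] (q : ℤ) : ModuleCat R :=
  (X.linearYonedaObj R (ModuleCat.of R N)).homology q

abbrev dd (X : CC R) (i j : ℤ) : X.X i →ₗ[R] X.X j := (X.d i j).hom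

def htEquiv (X : CC R) (N : Type) [AddCommGroup N] [Module R N] (p q r : ℤ) (hp : q + 1 = p)
    (hr : r + 1 = q) :
    HT X N q ≃ₗ[R] Hm (LinearMap.rTensor N (dd X p q)) (LinearMap.rTensor N (dd X q r)) :=
  homologyEquiv (TC X (ModuleCat.of R N)) p q r (by subst hp; simp) (by subst hr; simp)

def heEquiv (X : CC R) (N : Type) [AddCommGroup N] [Module R N] (p q r : ℤ) (hp : q + 1 = p)
    (hr : r + 1 = q) :
    HE X N q ≃ₗ[R] Hm (LinearMap.lcomp R N (dd X q r)) (LinearMap.lcomp R N (dd X p q)) := by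
  refine eT (homologyEquiv (X.linearYonedaObj R (ModuleCat.of R N)) r q p
    (by subst hr; simp) (by subst hp; simp)) ?_
  refine hmCongr _ _ _ _ (ModuleCat.homLinearEquiv (S := R)) ?_ ?_
  · intro b
    change (X.d p q ≫ b : X.X p ⟶ _) = 0 ↔ _
    rw [ModuleCat.hom_ext_iff]
    rfl
  · intro b
    constructor
    · rintro ⟨a, rfl⟩
      exact ⟨a.hom, rfl⟩
    · rintro ⟨a, ha⟩
      refine ⟨ModuleCat.ofHom a, ?_⟩
      change (X.d q r ≫ ModuleCat.ofHom a : X.X q ⟶ _) = _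
      ext1
      exact ha

end
end GorBetti

namespace GorBetti
open scoped TensorProduct


section
variable {R : Type} [CommRing R]

/-- local null-homotopy of multiplication by `y`. -/
def NH (X : CC R) (p q r : ℤ) (y : R) : Prop :=
  ∃ (s : X.X r →ₗ[R] X.X q) (t : X.X q →ₗ[R] X.X p),
    ∀ a, y • a = s (dd X q r a) + dd X p q (t a)

theorem dd_dd (X : CC R) (p q r : ℤ) (a : X.X p) : dd X q r (dd X p q a) = 0 := by
  have := X.d_comp_d p q r
  exact congrArg (fun f => f.hom a) this

theorem kill_congr {A B : Type} [AddCommGroup A] [Module R A] [AddCommGroup B] [Module R B]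
    (e : A ≃ₗ[R] B) {y : R} (h : ∀ b : B, y • b = 0) (a : A) : y • a = 0 := by
  apply e.injective
  rw [map_smul, h, map_zero]

theorem ht_kill (X : CC R) (N : Type) [AddCommGroup N] [Module R N] (p q r : ℤ) (hp : q + 1 = p)
    (hr : r + 1 = q) {y : R} (h : NH X p q r y) (z : HT X N q) : y • z = 0 := by
  refine kill_congr (htEquiv X N p q r hp hr) (hm_kill ?_) z
  obtain ⟨s, t, hst⟩ := h
  have key : ∀ b : X.X q ⊗[R] N, y • b = LinearMap.rTensor N s (LinearMap.rTensor N (dd X q r) b)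
      + LinearMap.rTensor N (dd X p q) (LinearMap.rTensor N t b) := by
    intro b
    induction b with
    | zero => simp
    | add a b ha hb => rw [smul_add, ha, hb]; simp only [map_add]; abel
    | tmul a n =>
      rw [TensorProduct.smul_tmul', hst]; simp [TensorProduct.add_tmul]
  intro b hb
  rw [key b, hb, map_zero, zero_add]
  exact ⟨_, rfl⟩

theorem he_kill (X : CC R) (N : Type) [AddCommGroup N] [Module R N] (p q r : ℤ) (hp : q + 1 = p)
    (hr : r + 1 = q) {y : R} (h : NH X p q r y) (z : HE X N q) : y • z = 0 := by
  refine kill_congr (heEquiv X N p q r hp hr) (hm_kill ?_) z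
  obtain ⟨s, t, hst⟩ := h
  intro b hb
  refine ⟨b ∘ₗ s, ?_⟩
  ext a
  have h2 : b (dd X p q (t a)) = 0 := LinearMap.congr_fun hb (t a)
  change b (s (dd X q r a)) = y • b a
  rw [← map_smul, hst, map_add, h2, add_zero]

theorem les_length {ι : Type} {c : ComplexShape ι}
    (S : ShortComplex (HomologicalComplex (ModuleCat.{0} R) c)) (hS : S.ShortExact) (i j : ι)
    (hij : c.Rel i j) (hi : HomologicalComplex.homologyMap S.f i = 0)
    (hj : HomologicalComplex.homologyMap S.f j = 0) :
    Module.length R (S.X₃.homology i) =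
      Module.length R (S.X₂.homology i) + Module.length R (S.X₁.homology j) := by
  have e1 := hS.homology_exact₁ i j hij
  have e2 := hS.homology_exact₂ i
  have e3 := hS.homology_exact₃ i j hij
  rw [ShortComplex.ShortExact.moduleCat_exact_iff_function_exact] at e3
  refine Module.length_eq_add_of_exact (HomologicalComplex.homologyMap S.g i).hom
    (hS.δ i j hij).hom ?_ ?_ e3
  · rw [← ModuleCat.mono_iff_injective]
    exact (ShortComplex.exact_iff_mono _ hi).1 e2
  · rw [← ModuleCat.epi_iff_surjective]
    exact (ShortComplex.exact_iff_epi _ hj).1 e1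

/-- functoriality of the tensor complex -/
abbrev tcMap (X : CC R) {N N' : ModuleCat.{0} R} (f : N ⟶ N') : TC X N ⟶ TC X N' :=
  (NatTrans.mapHomologicalComplex ((tensoringRight (ModuleCat.{0} R)).map f) _).app X

/-- functoriality of the hom complex -/
def hcMap (X : CC R) {N N' : ModuleCat.{0} R} (f : N ⟶ N') :
    X.linearYonedaObj R N ⟶ X.linearYonedaObj R N' where
  f i := ModuleCat.ofHom (CategoryTheory.Linear.rightComp R (X.X i) f)
  comm' i j _ := by
    ext a
    change (X.X i ⟶ N) at a
    exact (Category.assoc (X.d j i) a f).symm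

theorem homologyMap_zero_of_smul {ι : Type} {c : ComplexShape ι}
    (K : HomologicalComplex (ModuleCat.{0} R) c) (f : K ⟶ K) (y : R) (hf : f = y • 𝟙 K) (i : ι)
    (h : ∀ z : K.homology i, y • z = 0) : HomologicalComplex.homologyMap f i = 0 := by
  have e : HomologicalComplex.homologyMap f i = y • 𝟙 (K.homology i) := by
    rw [hf, ← HomologicalComplex.homologyMap_id]
    exact ShortComplex.homologyMap_smul
      ((HomologicalComplex.shortComplexFunctor _ c i).map (𝟙 K)) y
  rw [e]
  ext z
  exact h z

variable {N N' : Type} [AddCommGroup N] [Module R N] [AddCommGroup N'] [Module R N']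

theorem ht_length (X : CC R) (hX : ∀ i, Module.Projective R (X.X i)) (y : R) (g : N →ₗ[R] N')
    (hy : ∀ a : N, y • a = 0 → a = 0) (hg : Function.Surjective g)
    (he : ∀ a, g a = 0 ↔ ∃ b, y • b = a) (q r : ℤ) (hr : r + 1 = q)
    (hq : ∀ z : HT X N q, y • z = 0) (hr' : ∀ z : HT X N r, y • z = 0) :
    Module.length R (HT X N' q) = Module.length R (HT X N q) + Module.length R (HT X N r) := by
  let f : N →ₗ[R] N := y • LinearMap.id
  have hf : Function.Injective f := by
    rw [← LinearMap.ker_eq_bot, LinearMap.ker_eq_bot']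
    exact hy
  have hex : Function.Exact f g := fun a => he a
  have w : tcMap X (ModuleCat.ofHom f) ≫ tcMap X (ModuleCat.ofHom g) = 0 := by
    refine HomologicalComplex.hom_ext _ _ (fun i => ModuleCat.hom_ext
      (TensorProduct.ext' fun a n => ?_))
    change a ⊗ₜ[R] (g (f n)) = 0
    rw [hex.apply_apply_eq_zero, TensorProduct.tmul_zero]
  let S : ShortComplex (CC R) := ShortComplex.mk _ _ w
  have hS : S.ShortExact := by
    rw [HomologicalComplex.shortExact_iff_degreewise_shortExact]
    intro i
    have : Module.Projective R (X.X i) := hX i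
    exact ses_of (LinearMap.lTensor (X.X i) f) (LinearMap.lTensor (X.X i) g)
      (Module.Flat.lTensor_preserves_injective_linearMap f hf) (LinearMap.lTensor_surjective _ hg)
      (lTensor_exact _ hex hg)
  have hfe : tcMap X (ModuleCat.ofHom f) = y • 𝟙 (TC X (ModuleCat.of R N)) := by
    refine HomologicalComplex.hom_ext _ _ (fun i => ModuleCat.hom_ext
      (TensorProduct.ext' fun a n => ?_))
    change a ⊗ₜ[R] (y • n) = y • (a ⊗ₜ[R] n)
    rw [TensorProduct.tmul_smul]
  refine les_length S hS q r ?_ (homologyMap_zero_of_smul _ _ y hfe _ hq)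
    (homologyMap_zero_of_smul _ _ y hfe _ hr')
  simpa using hr

theorem he_length (X : CC R) (hX : ∀ i, Module.Projective R (X.X i)) (y : R) (g : N →ₗ[R] N')
    (hy : ∀ a : N, y • a = 0 → a = 0) (hg : Function.Surjective g)
    (he : ∀ a, g a = 0 ↔ ∃ b, y • b = a) (q p : ℤ) (hp : q + 1 = p)
    (hq : ∀ z : HE X N q, y • z = 0) (hp' : ∀ z : HE X N p, y • z = 0) :
    Module.length R (HE X N' q) = Module.length R (HE X N q) + Module.length R (HE X N p) := by
  let f : N →ₗ[R] N := y • LinearMap.id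
  have hf : Function.Injective f := by
    rw [← LinearMap.ker_eq_bot, LinearMap.ker_eq_bot']
    exact hy
  have hex : Function.Exact f g := fun a => he a
  have w : hcMap X (ModuleCat.ofHom f) ≫ hcMap X (ModuleCat.ofHom g) = 0 := by
    ext i a
    change (_ : X.X i ⟶ ModuleCat.of R N') = 0
    ext n
    exact hex.apply_apply_eq_zero _
  let S : ShortComplex (CochainComplex (ModuleCat.{0} R) ℤ) := ShortComplex.mk _ _ w
  have hS : S.ShortExact := by
    rw [HomologicalComplex.shortExact_iff_degreewise_shortExact]
    intro i
    have : Module.Projective R (X.X i) := hX i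
    refine ModuleCat.shortComplex_shortExact _ ?_ ?_ ?_
    · intro b
      change (X.X i ⟶ ModuleCat.of R N) at b
      constructor
      · intro hb
        have hb' : ∀ n, g (b.hom n) = 0 := fun n => congrArg (fun k => ModuleCat.Hom.hom k n) hb
        choose b' hb'' using fun n => (hex _).1 (hb' n)
        refine ⟨ModuleCat.ofHom
          { toFun := b'
            map_add' := fun m n => hf (by rw [hb'', map_add, map_add, hb'', hb''])
            map_smul' := fun m n => hf (by
              rw [hb'', map_smul, map_smul, hb'']; rfl) }, ?_⟩
        change (_ : X.X i ⟶ ModuleCat.of R N) = b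
        ext n
        exact hb'' n
      · rintro ⟨a, rfl⟩
        change (_ : X.X i ⟶ ModuleCat.of R N') = 0
        ext n
        exact hex.apply_apply_eq_zero _
    · intro a b hab
      change (X.X i ⟶ ModuleCat.of R N) at a b
      change (a : X.X i ⟶ ModuleCat.of R N) = b
      ext n
      exact hf (congrArg (fun k => ModuleCat.Hom.hom k n) hab)
    · intro b
      change (X.X i ⟶ ModuleCat.of R N') at b
      obtain ⟨a, ha⟩ := Module.projective_lifting_property g b.hom hg
      refine ⟨ModuleCat.ofHom a, ?_⟩
      change (_ : X.X i ⟶ ModuleCat.of R N') = b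
      ext n
      exact LinearMap.congr_fun ha n
  have hfe : hcMap X (ModuleCat.ofHom f) = y • 𝟙 (X.linearYonedaObj R (ModuleCat.of R N)) := by
    ext i a
    rfl
  refine les_length S hS q p ?_ (homologyMap_zero_of_smul _ _ y hfe _ hq)
    (homologyMap_zero_of_smul _ _ y hfe _ hp')
  simpa using hp

end
end GorBetti

namespace GorBetti
open scoped TensorProduct


section
variable {R : Type} [CommRing R] {S : Type} [CommRing S] [Algebra R S]

/-- the module structure over a quotient ring on a module killed by the kernel. -/
abbrev qmod (hs : Function.Surjective (algebraMap R S)) (M : Type) [AddCommGroup M] [Module R M]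
    (hk : ∀ r, algebraMap R S r = 0 → ∀ x : M, r • x = 0) : Module S M :=
  letI : SMul S M := ⟨fun s x => (Function.surjInv hs s) • x⟩
  Function.Surjective.moduleLeft (algebraMap R S) hs (fun c x => by
    change Function.surjInv hs (algebraMap R S c) • x = c • x
    rw [← sub_eq_zero, ← sub_smul]
    apply hk
    rw [map_sub, Function.surjInv_eq hs, sub_self])

theorem qmod_smul (hs : Function.Surjective (algebraMap R S)) (M : Type) [AddCommGroup M]
    [Module R M] (hk : ∀ r, algebraMap R S r = 0 → ∀ x : M, r • x = 0) (c : R) (x : M) :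
    letI := qmod hs M hk
    algebraMap R S c • x = c • x := by
  letI := qmod hs M hk
  change Function.surjInv hs (algebraMap R S c) • x = c • x
  rw [← sub_eq_zero, ← sub_smul]
  apply hk
  rw [map_sub, Function.surjInv_eq hs, sub_self]

theorem ext_inj (hs : Function.Surjective (algebraMap R S)) (hS : Module.Injective S S)
    {M M' : Type} [AddCommGroup M] [Module R M] [AddCommGroup M'] [Module R M']
    (i : M →ₗ[R] M') (hi : Function.Injective i)
    (hk : ∀ r, algebraMap R S r = 0 → ∀ x : M', r • x = 0) (φ : M →ₗ[R] S) :
    ∃ ψ : M' →ₗ[R] S, ∀ m, ψ (i m) = φ m := by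
  have hk' : ∀ r, algebraMap R S r = 0 → ∀ x : M, r • x = 0 := by
    intro r hr x
    apply hi
    rw [map_smul, hk r hr, map_zero]
  letI := qmod hs M hk'
  letI := qmod hs M' hk
  have e1 : ∀ (c : R) (x : M), algebraMap R S c • x = c • x := qmod_smul hs M hk'
  have e2 : ∀ (c : R) (x : M'), algebraMap R S c • x = c • x := qmod_smul hs M' hk
  let iS : M →ₗ[S] M' :=
    { toFun := i
      map_add' := map_add i
      map_smul' := fun s x => by
        obtain ⟨c, rfl⟩ := hs s
        rw [e1, map_smul]; exact (e2 _ _).symm }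
  let φS : M →ₗ[S] S :=
    { toFun := φ
      map_add' := map_add φ
      map_smul' := fun s x => by
        obtain ⟨c, rfl⟩ := hs s
        rw [e1, map_smul]; exact (algebraMap_smul S c (φ x)).symm }
  obtain ⟨ψ, hψ⟩ := hS.out iS hi φS
  refine ⟨{ toFun := ψ, map_add' := map_add ψ, map_smul' := fun c x => ?_ }, hψ⟩
  rw [← e2, map_smul]; exact (algebraMap_smul S c (ψ x))

section
variable {A B C : Type} [AddCommGroup A] [Module R A] [AddCommGroup B] [Module R B]
  [AddCommGroup C] [Module R C]

/-- extension of scalars of a functional. -/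
def tl (S : Type) [CommRing S] [Algebra R S] (B : Type) [AddCommGroup B] [Module R B] :
    (B →ₗ[R] S) →ₗ[R] (B ⊗[R] S →ₗ[R] S) :=
  LinearMap.compRight R (LinearMap.mul' R S) ∘ₗ LinearMap.rTensorHom S

theorem tl_tmul (φ : B →ₗ[R] S) (b : B) (s : S) : tl S B φ (b ⊗ₜ s) = φ b * s := rfl

theorem tl_rTensor (φ : B →ₗ[R] S) (f : A →ₗ[R] B) (z : A ⊗[R] S) :
    tl S B φ (LinearMap.rTensor S f z) = tl S A (φ ∘ₗ f) z := by
  induction z with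
  | zero => simp
  | add a b ha hb => simp only [map_add, ha, hb]
  | tmul a s => rfl

/-- the restriction of a functional to the base. -/
def ub (η : B ⊗[R] S →ₗ[R] S) : B →ₗ[R] S := η ∘ₗ (TensorProduct.mk R B S).flip 1

theorem tl_ub (hs : Function.Surjective (algebraMap R S)) (η : B ⊗[R] S →ₗ[R] S) :
    tl S B (ub η) = η := by
  apply TensorProduct.ext'
  intro b s
  obtain ⟨r, rfl⟩ := hs s
  rw [tl_tmul]
  change η (b ⊗ₜ 1) * _ = _
  rw [Algebra.algebraMap_eq_smul_one, TensorProduct.tmul_smul, map_smul, mul_smul_comm, mul_one]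

theorem tens_kill (hs : Function.Surjective (algebraMap R S)) (r : R) (hr : algebraMap R S r = 0)
    (z : B ⊗[R] S) : r • z = 0 := by
  induction z with
  | zero => simp
  | add a b ha hb => rw [smul_add, ha, hb, add_zero]
  | tmul a s =>
    rw [← TensorProduct.tmul_smul, Algebra.smul_def, hr, zero_mul, TensorProduct.tmul_zero]

/-- The comparison map. -/
def dualMapHm (f : A →ₗ[R] B) (g : B →ₗ[R] C) :
    LinearMap.ker (LinearMap.lcomp R S f) →ₗ[R]
      (Hm (LinearMap.rTensor S f) (LinearMap.rTensor S g) →ₗ[R] S) where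
  toFun φ := Submodule.liftQ _ ((tl S B φ.1) ∘ₗ (LinearMap.ker (LinearMap.rTensor S g)).subtype) (by
    rintro ⟨b, hb⟩ ⟨z, hz⟩
    have hz : LinearMap.rTensor S f z = b := hz
    have hφ : φ.1 ∘ₗ f = 0 := φ.2
    change tl S B φ.1 b = 0
    rw [← hz, tl_rTensor, hφ, map_zero, LinearMap.zero_apply])
  map_add' φ ψ := by ext z; simp
  map_smul' r ψ := by ext z; simp

theorem dualMapHm_apply (f : A →ₗ[R] B) (g : B →ₗ[R] C)
    (φ : LinearMap.ker (LinearMap.lcomp R S f)) (b : LinearMap.ker (LinearMap.rTensor S g)) :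
    dualMapHm f g φ (Submodule.Quotient.mk b) = tl S B φ.1 b.1 := rfl

theorem dualMapHm_surj (hs : Function.Surjective (algebraMap R S)) (hS : Module.Injective S S)
    (f : A →ₗ[R] B) (g : B →ₗ[R] C) (hgf : g ∘ₗ f = 0) :
    Function.Surjective (dualMapHm (S := S) f g) := by
  intro ω
  obtain ⟨η, hη⟩ := ext_inj hs hS (LinearMap.ker (LinearMap.rTensor S g)).subtype
    Subtype.val_injective (tens_kill hs) (ω ∘ₗ Submodule.mkQ _)
  refine ⟨⟨ub η, ?_⟩, ?_⟩
  · ext a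
    have h0 : LinearMap.rTensor S g (f a ⊗ₜ 1) = 0 := by
      have : g (f a) = 0 := LinearMap.congr_fun hgf a
      simp [this]
    have := hη ⟨f a ⊗ₜ 1, h0⟩
    change η (f a ⊗ₜ 1) = 0
    refine this.trans ?_
    change ω (Submodule.Quotient.mk _) = 0
    rw [(Submodule.Quotient.mk_eq_zero _).2, map_zero]
    exact ⟨a ⊗ₜ 1, rfl⟩
  · refine LinearMap.ext (fun z => ?_)
    obtain ⟨b, rfl⟩ := Submodule.Quotient.mk_surjective _ z
    rw [dualMapHm_apply]
    change tl S B (ub η) b.1 = _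
    rw [tl_ub hs]
    exact hη b

theorem dualMapHm_ker (hs : Function.Surjective (algebraMap R S)) (hS : Module.Injective S S)
    (f : A →ₗ[R] B) (g : B →ₗ[R] C) (hgf : g ∘ₗ f = 0) :
    LinearMap.ker (dualMapHm (S := S) f g) =
      (LinearMap.range (LinearMap.lcomp R S g)).submoduleOf (LinearMap.ker (LinearMap.lcomp R S f)) := by
  ext φ
  constructor
  · intro h
    have h' : ∀ b, LinearMap.rTensor S g b = 0 → tl S B φ.1 b = 0 := fun b hb =>
      LinearMap.congr_fun h (Submodule.Quotient.mk ⟨b, hb⟩)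
    obtain ⟨ψ, hψ⟩ := ext_inj hs hS
      ((LinearMap.ker (LinearMap.rTensor S g)).liftQ (LinearMap.rTensor S g) le_rfl)
      (by rw [← LinearMap.ker_eq_bot]; exact Submodule.ker_liftQ_eq_bot _ _ _ le_rfl)
      (tens_kill hs)
      ((LinearMap.ker (LinearMap.rTensor S g)).liftQ (tl S B φ.1) h')
    refine ⟨ub ψ, ?_⟩
    ext b
    have := hψ (Submodule.Quotient.mk (b ⊗ₜ 1))
    change ψ (g b ⊗ₜ 1) = _
    refine this.trans ?_
    change φ.1 b * 1 = φ.1 b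
    rw [mul_one]
  · rintro ⟨ψ, hψ⟩
    have hψ : ψ ∘ₗ g = φ.1 := hψ
    refine LinearMap.ext (fun z => ?_)
    obtain ⟨b, rfl⟩ := Submodule.Quotient.mk_surjective _ z
    rw [dualMapHm_apply, ← hψ, ← tl_rTensor, b.2, map_zero]; rfl

/-- `H(Hom(-,S)) = Hom(H(- ⊗ S), S)` for self-injective `S`. -/
def dualHm (hs : Function.Surjective (algebraMap R S)) (hS : Module.Injective S S)
    (f : A →ₗ[R] B) (g : B →ₗ[R] C) (hgf : g ∘ₗ f = 0) :
    Hm (LinearMap.lcomp R S g) (LinearMap.lcomp R S f) ≃ₗ[R]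
      (Hm (LinearMap.rTensor S f) (LinearMap.rTensor S g) →ₗ[R] S) :=
  eT (Submodule.quotEquivOfEq _ _ (dualMapHm_ker hs hS f g hgf).symm)
    (LinearMap.quotKerEquivOfSurjective _ (dualMapHm_surj hs hS f g hgf))

end

variable [IsLocalRing R]

theorem res_surj : Function.Surjective (algebraMap R (IsLocalRing.ResidueField R)) :=
  IsLocalRing.residue_surjective

/-- a finitely generated module killed by the maximal ideal is a power of the residue field. -/
theorem killed_equiv (W : Type) [AddCommGroup W] [Module R W] [Module.Finite R W]
    (hk : ∀ y ∈ IsLocalRing.maximalIdeal R, ∀ x : W, y • x = 0) :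
    ∃ d : ℕ, Nonempty (W ≃ₗ[R] (Fin d → IsLocalRing.ResidueField R)) := by
  have hk' : ∀ r, algebraMap R (IsLocalRing.ResidueField R) r = 0 → ∀ x : W, r • x = 0 :=
    fun r hr x => hk r ((IsLocalRing.residue_eq_zero_iff r).1 hr) x
  letI := qmod res_surj W hk'
  haveI : IsScalarTower R (IsLocalRing.ResidueField R) W :=
    IsScalarTower.of_algebraMap_smul (qmod_smul res_surj W hk')
  haveI : Module.Finite (IsLocalRing.ResidueField R) W := Module.Finite.of_restrictScalars_finite R _ _
  refine ⟨_, ⟨(Module.finBasis (IsLocalRing.ResidueField R) W).equivFun.restrictScalars R⟩⟩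

theorem length_res : Module.length R (IsLocalRing.ResidueField R) = 1 := by
  rw [Module.length_eq_one_iff]
  exact isSimpleModule_iff_isCoatom.2 (IsLocalRing.maximalIdeal.isMaximal R).out

theorem length_hom_res (hs : Function.Surjective (algebraMap R S)) (hS : Module.Injective S S)
    (hsoc : ∃ x : S, x ≠ 0 ∧ ∀ y ∈ IsLocalRing.maximalIdeal R, y • x = 0)  :
    Module.length R (IsLocalRing.ResidueField R →ₗ[R] S) = 1 := by
  rw [Module.length_eq_one_iff, isSimpleModule_iff_toSpanSingleton_surjective]
  obtain ⟨x, hx, hxm⟩ := hsoc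
  let φ0 : IsLocalRing.ResidueField R →ₗ[R] S :=
    Submodule.liftQ (IsLocalRing.maximalIdeal R) (LinearMap.toSpanSingleton R S x) hxm
  have hφ0 : φ0 ≠ 0 := by
    intro h
    apply hx
    have := LinearMap.congr_fun h (Submodule.Quotient.mk 1)
    change (1:R) • x = 0 at this
    simpa using this
  refine ⟨⟨φ0, 0, hφ0⟩, ?_⟩
  intro φ hφ ψ
  have hinj : Function.Injective φ := by
    have hsim : IsSimpleModule R (IsLocalRing.ResidueField R) := Module.length_eq_one_iff.1 length_res
    exact (LinearMap.injective_or_eq_zero φ).resolve_right hφ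
  obtain ⟨η, hη⟩ := ext_inj hs hS φ hinj (fun r hr x => by
    rw [Algebra.smul_def, hr, zero_mul]) ψ
  obtain ⟨r, hr⟩ := hs (η 1)
  refine ⟨r, ?_⟩
  ext z
  change r • φ z = ψ z
  rw [← hη]
  obtain ⟨c, hc⟩ := hs (φ z)
  rw [← hc, Algebra.algebraMap_eq_smul_one, map_smul, ← hr, smul_comm,
    Algebra.algebraMap_eq_smul_one]

theorem length_hom_killed (hs : Function.Surjective (algebraMap R S)) (hS : Module.Injective S S)
    (hsoc : ∃ x : S, x ≠ 0 ∧ ∀ y ∈ IsLocalRing.maximalIdeal R, y • x = 0)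
    (W : Type) [AddCommGroup W] [Module R W] [Module.Finite R W]
    (hk : ∀ y ∈ IsLocalRing.maximalIdeal R, ∀ x : W, y • x = 0) :
    Module.length R (W →ₗ[R] S) = Module.length R W := by
  obtain ⟨d, ⟨e⟩⟩ := killed_equiv W hk
  rw [e.length_eq, (LinearEquiv.congrLeft S R e).length_eq,
    ← (LinearMap.lsum R (fun _ : Fin d => IsLocalRing.ResidueField R) R (M := S)).length_eq,
    Module.length_pi, Module.length_pi, length_hom_res hs hS hsoc, length_res]

theorem he_eq_ht [IsNoetherianRing R] (X : CC R) (hX : ∀ i, Module.Finite R (X.X i))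
    (hs : Function.Surjective (algebraMap R S)) (hS : Module.Injective S S)
    (hsoc : ∃ x : S, x ≠ 0 ∧ ∀ y ∈ IsLocalRing.maximalIdeal R, y • x = 0)
    (q : ℤ)
    (hk : ∀ y ∈ IsLocalRing.maximalIdeal R, ∀ z : HT X S q, y • z = 0) :
    Module.length R (HE X S q) = Module.length R (HT X S q) := by
  have hgf : dd X q (q-1) ∘ₗ dd X (q+1) q = 0 := by
    ext a; exact dd_dd X _ _ _ a
  have e1 := htEquiv X S (q+1) q (q-1) rfl (by ring)
  rw [(heEquiv X S (q+1) q (q-1) rfl (by ring)).length_eq, e1.length_eq,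
    (dualHm hs hS (dd X (q+1) q) (dd X q (q-1)) hgf).length_eq]
  haveI := hX q
  haveI : Module.Finite R S := Module.Finite.of_surjective (Algebra.linearMap R S) hs
  refine length_hom_killed hs hS hsoc _ ?_
  intro y hy z
  exact kill_congr e1.symm (hk y hy) z

end
end GorBetti

namespace GorBetti
open scoped TensorProduct


section
variable {R : Type} [CommRing R] [IsLocalRing R] [IsNoetherianRing R]

theorem finite_hom (A N : Type) [AddCommGroup A] [Module R A] [AddCommGroup N] [Module R N]
    [Module.Finite R A] [Module.Finite R N] : Module.Finite R (A →ₗ[R] N) := by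
  obtain ⟨n, f, hf⟩ := Module.Finite.exists_fin' R A
  have : Module.Finite R ((Fin n → R) →ₗ[R] N) := inferInstance
  exact Module.Finite.of_injective (LinearMap.lcomp R N f) (fun a b h => by
    ext z
    obtain ⟨w, rfl⟩ := hf z
    exact LinearMap.congr_fun h w)

theorem ht_finite (X : CC R) (hX : ∀ i, Module.Finite R (X.X i)) (N : Type) [AddCommGroup N]
    [Module R N] [Module.Finite R N] (q : ℤ) : Module.Finite R (HT X N q) := by
  have := hX q
  exact Module.Finite.equiv (htEquiv X N (q+1) q (q-1) rfl (by ring)).symm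

theorem he_finite (X : CC R) (hX : ∀ i, Module.Finite R (X.X i)) (N : Type) [AddCommGroup N]
    [Module R N] [Module.Finite R N] (q : ℤ) : Module.Finite R (HE X N q) := by
  have := hX q
  have := finite_hom (R := R) (X.X q) N
  exact Module.Finite.equiv (heEquiv X N (q+1) q (q-1) rfl (by ring)).symm

theorem length_killed (W : Type) [AddCommGroup W] [Module R W] [Module.Finite R W]
    (hk : ∀ y ∈ IsLocalRing.maximalIdeal R, ∀ x : W, y • x = 0) :
    ∃ d : ℕ, Module.length R W = d := by
  obtain ⟨d, ⟨e⟩⟩ := killed_equiv W hk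
  refine ⟨d, ?_⟩
  rw [e.length_eq, Module.length_pi, length_res]; simp

theorem equiv_of_length (W W' : Type) [AddCommGroup W] [Module R W] [Module.Finite R W]
    [AddCommGroup W'] [Module R W'] [Module.Finite R W']
    (hk : ∀ y ∈ IsLocalRing.maximalIdeal R, ∀ x : W, y • x = 0)
    (hk' : ∀ y ∈ IsLocalRing.maximalIdeal R, ∀ x : W', y • x = 0)
    (h : Module.length R W = Module.length R W') : Nonempty (W ≃ₗ[R] W') := by
  obtain ⟨d, ⟨e⟩⟩ := killed_equiv W hk
  obtain ⟨d', ⟨e'⟩⟩ := killed_equiv W' hk'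
  rw [e.length_eq, e'.length_eq, Module.length_pi, Module.length_pi, length_res] at h
  have : d = d' := by simpa using h
  subst this
  exact ⟨e.trans e'.symm⟩

theorem int_zero (δ : ℤ → ℤ) (h : ∀ q, δ q + δ (q - 1) = 0) (q0 : ℤ) (h0 : δ q0 = 0) (q : ℤ) :
    δ q = 0 := by
  induction q using Int.inductionOn' (b := q0) with
  | zero => exact h0
  | succ k _ ih => have := h (k+1); rw [add_sub_cancel_right] at this; omega
  | pred k _ ih => have := h k; omega

/-- the general form of the duality between `Hom` and tensor -/
theorem he_ht (X : CC R) (hf : ∀ i, Module.Finite R (X.X i))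
    (hp : ∀ i, Module.Projective R (X.X i))
    (hNH : ∀ y ∈ IsLocalRing.maximalIdeal R, ∀ q, NH X (q+1) q (q-1) y)
    (h0 : ∀ (S : Type) [CommRing S] [Algebra R S] (n : ℕ), ∃ q0 : ℤ,
      ∀ (r : ℕ), Function.Surjective (algebraMap R S) → IsLocalRing S → IsNoetherianRing S →
       ringKrullDim S = n → IDLT S S r →
       Module.length R (HE X S (n + q0)) = Module.length R (HT X S q0)) :
    ∀ (n : ℕ) (S : Type) [CommRing S] [Algebra R S] (r : ℕ),
      Function.Surjective (algebraMap R S) → IsLocalRing S → IsNoetherianRing S →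
       ringKrullDim S = n → IDLT S S r →
       ∀ q : ℤ, Module.length R (HE X S (n + q)) = Module.length R (HT X S q) := by
  intro n
  induction n with
  | zero =>
    intro S _ _ r hs hl hN hd hi q
    rcases gor_cases 0 hd r hi with ⟨_, hinj⟩ | ⟨n', h, _⟩
    · have e : ((0:ℕ):ℤ) + q = q := by simp
      rw [e]
      refine he_eq_ht X hf hs hinj ?_ q
        (fun y hy z => ht_kill X S (q+1) q (q-1) rfl (by ring) (hNH y hy q) z)
      obtain ⟨P, hP⟩ := associatedPrimes.nonempty S S
      obtain ⟨hPp, x, hx⟩ := isAssociatedPrime_iff.1 hP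
      have hdim : Ring.KrullDimLE 0 S := by
        rw [Ring.krullDimLE_iff]; exact hd.le
      have hmax : P = IsLocalRing.maximalIdeal S :=
        IsLocalRing.eq_maximalIdeal (Ideal.isMaximal_of_isPrime P)
      have hm : ∀ y ∈ IsLocalRing.maximalIdeal R, algebraMap R S y ∈ P := by
        intro y hy
        have := Ideal.comap_isMaximal_of_surjective (algebraMap R S) hs (K := IsLocalRing.maximalIdeal S)
        have := IsLocalRing.eq_maximalIdeal this
        rw [hmax, ← Ideal.mem_comap, this]; exact hy
      refine ⟨x, ?_, ?_⟩
      · rintro rfl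
        apply hPp.ne_top
        rw [hx]
        ext; simp
      · intro y hy
        have := hm y hy
        rw [hx] at this
        simpa [Algebra.smul_def] using this
    · omega
  | succ n ih =>
    intro S _ _ r hs hl hN hd hi q
    rcases gor_cases (n+1) hd r hi with ⟨h, _⟩ | ⟨n', hn', x, hx, hreg, hd', hi'⟩
    · omega
    obtain rfl : n = n' := by omega
    have hm : Ideal.comap (algebraMap R S) (IsLocalRing.maximalIdeal S) =
        IsLocalRing.maximalIdeal R := IsLocalRing.eq_maximalIdeal
        (Ideal.comap_isMaximal_of_surjective (algebraMap R S) hs (K := IsLocalRing.maximalIdeal S))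
    obtain ⟨ξ, hξ⟩ := hs x
    have hξm : ξ ∈ IsLocalRing.maximalIdeal R := by
      rw [← hm, Ideal.mem_comap, hξ]; exact hx
    have hnt : Nontrivial (S ⧸ Ideal.span {x}) := by
      rw [Ideal.Quotient.nontrivial_iff]
      intro h
      have h1 : (1:S) ∈ IsLocalRing.maximalIdeal S := by
        have : Ideal.span {x} ≤ IsLocalRing.maximalIdeal S := by
          rw [Ideal.span_le]; simpa using hx
        exact this (h ▸ Submodule.mem_top)
      exact (Ideal.ne_top_iff_one _).1 (IsLocalRing.maximalIdeal.isMaximal S).ne_top h1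
    have hl' : IsLocalRing (S ⧸ Ideal.span {x}) :=
      IsLocalRing.of_surjective' _ Ideal.Quotient.mk_surjective
    have hs' : Function.Surjective (algebraMap R (S ⧸ Ideal.span {x})) := by
      have : (algebraMap R (S ⧸ Ideal.span {x}) : R → _) =
        (Ideal.Quotient.mk (Ideal.span {x})) ∘ (algebraMap R S) := rfl
      rw [this]
      exact Ideal.Quotient.mk_surjective.comp hs
    have IH := ih (S ⧸ Ideal.span {x}) (r+1) hs' hl' inferInstance hd' hi'
    haveI : Module.Finite R S := Module.Finite.of_surjective (Algebra.linearMap R S) hs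
    have kt : ∀ q, ∀ y ∈ IsLocalRing.maximalIdeal R, ∀ z : HT X S q, y • z = 0 := fun q y hy z =>
      ht_kill X S (q+1) q (q-1) rfl (by ring) (hNH y hy q) z
    have ke : ∀ q, ∀ y ∈ IsLocalRing.maximalIdeal R, ∀ z : HE X S q, y • z = 0 := fun q y hy z =>
      he_kill X S (q+1) q (q-1) rfl (by ring) (hNH y hy q) z
    let g : S →ₗ[R] (S ⧸ Ideal.span {x}) := (Ideal.Quotient.mkₐ R (Ideal.span {x})).toLinearMap
    have hg : Function.Surjective g := Ideal.Quotient.mk_surjective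
    have hsm : ∀ b : S, ξ • b = b * x := fun b => by rw [Algebra.smul_def, hξ, mul_comm]
    have hy : ∀ a : S, ξ • a = 0 → a = 0 := by
      intro a ha
      rw [hsm] at ha
      exact (mem_nonZeroDivisors_iff.1 hreg).2 a ha
    have he : ∀ a, g a = 0 ↔ ∃ b : S, ξ • b = a := by
      intro a
      change Ideal.Quotient.mk (Ideal.span {x}) a = 0 ↔ _
      rw [Ideal.Quotient.eq_zero_iff_mem, Ideal.mem_span_singleton']
      simp only [hsm]
    have L1 : ∀ q, Module.length R (HT X (S ⧸ Ideal.span {x}) q) =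
        Module.length R (HT X S q) + Module.length R (HT X S (q-1)) := fun q =>
      ht_length X hp ξ g hy hg he q (q-1) (by ring) (kt q ξ hξm) (kt (q-1) ξ hξm)
    have L2 : ∀ q, Module.length R (HE X (S ⧸ Ideal.span {x}) q) =
        Module.length R (HE X S q) + Module.length R (HE X S (q+1)) := fun q =>
      he_length X hp ξ g hy hg he q (q+1) rfl (ke q ξ hξm) (ke (q+1) ξ hξm)
    have ft := ht_finite X hf S
    have fe := he_finite X hf S
    choose ht hht using fun q => length_killed (HT X S q) (kt q)
    choose he' hhe using fun q => length_killed (HE X S q) (ke q)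
    obtain ⟨q0, hq0⟩ := h0 S (n+1)
    have hq0 := hq0 r hs hl hN hd hi
    rw [hht, hhe] at hq0
    have key := int_zero (fun q => (he' ((n+1 : ℕ) + q) : ℤ) - ht q) (fun q => by
      have a1 := IH q
      rw [L1, L2, hht, hht, hhe, hhe] at a1
      have a2 : he' (n + q) + he' (n+q+1) = ht q + ht (q-1) := by exact_mod_cast a1
      have e1 : ((n+1:ℕ):ℤ) + q = n + q + 1 := by push_cast; ring
      have e2 : ((n+1:ℕ):ℤ) + (q-1) = n + q := by push_cast; ring
      simp only [e1, e2]
      omega) q0 (by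
        have : he' ((n+1:ℕ) + q0) = ht q0 := by exact_mod_cast hq0
        simp only [this]; ring) q
    rw [hht, hhe]
    have key : (he' ((n+1 : ℕ) + q) : ℤ) - ht q = 0 := key
    have : he' ((n+1 : ℕ) + q) = ht q := by omega
    rw [this]

end
end GorBetti

namespace GorBetti
open scoped TensorProduct


section
variable {R : Type} [CommRing R]

/-- Resolution by finitely generated projectives. -/
structure FRes (R : Type) [CommRing R] (M : Type) [AddCommGroup M] [Module R M] where
  X : CC R
  π : X.X 0 →ₗ[R] M
  proj : ∀ i, Module.Projective R (X.X i)
  fg : ∀ i, Module.Finite R (X.X i)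
  zero : ∀ i : ℤ, i < 0 → Subsingleton (X.X i)
  surj : Function.Surjective π
  ex0 : Function.Exact (dd X 1 0) π
  ex : ∀ p q r : ℤ, q + 1 = p → r + 1 = q → 0 < q → Function.Exact (dd X p q) (dd X q r)

/-- Totally acyclic complexes, concretely. -/
structure TAc (X : CC R) : Prop where
  proj : ∀ i, Module.Projective R (X.X i)
  fg : ∀ i, Module.Finite R (X.X i)
  ex : ∀ p q r : ℤ, q + 1 = p → r + 1 = q → Function.Exact (dd X p q) (dd X q r)
  exd : ∀ p q r : ℤ, q + 1 = p → r + 1 = q → ∀ φ : X.X q →ₗ[R] R, φ ∘ₗ dd X p q = 0 →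
    ∃ ψ : X.X r →ₗ[R] R, ψ ∘ₗ dd X q r = φ

/-- comparison in high degrees. -/
structure Cmp (T P : CC R) (n₀ : ℤ) where
  e : ∀ i, n₀ ≤ i → T.X i ≃ₗ[R] P.X i
  comm : ∀ i j (hi : n₀ ≤ i) (hj : n₀ ≤ j) (a : T.X i), e j hj (dd T i j a) = dd P i j (e i hi a)

theorem lift_exact {A B C D : Type} [AddCommGroup A] [Module R A] [AddCommGroup B] [Module R B]
    [AddCommGroup C] [Module R C] [AddCommGroup D] [Module R D] [Module.Projective R A]
    (f : C →ₗ[R] B) (g : B →ₗ[R] D) (h : Function.Exact f g) (u : A →ₗ[R] B)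
    (hu : ∀ a, g (u a) = 0) : ∃ t : A →ₗ[R] C, ∀ a, f (t a) = u a := by
  obtain ⟨t, ht⟩ := Module.projective_lifting_property f.rangeRestrict
    (u.codRestrict (LinearMap.range f) (fun a => (h _).1 (hu a))) f.surjective_rangeRestrict
  exact ⟨t, fun a => congrArg Subtype.val (LinearMap.congr_fun ht a)⟩

theorem nh_sub (X : CC R) (y : R) (p q r : ℤ) (h : Subsingleton (X.X q)) : NH X p q r y :=
  ⟨0, 0, fun a => Subsingleton.elim _ _⟩

theorem FRes.nh {M : Type} [AddCommGroup M] [Module R M] (F : FRes R M) (y : R)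
    (hy : ∀ a : M, y • a = 0) (q : ℤ) : NH F.X (q+1) q (q-1) y := by
  have main : ∀ (m : ℕ) (p q r : ℤ), q = m → q + 1 = p → r + 1 = q → NH F.X p q r y := by
    intro m
    induction m with
    | zero =>
      intro p q r hq hp hr
      obtain rfl : q = 0 := by simpa using hq
      obtain rfl : p = 1 := by omega
      have := F.proj 0
      obtain ⟨t, ht⟩ := lift_exact (dd F.X 1 0) F.π F.ex0 (y • LinearMap.id)
        (fun a => by change F.π (y • a) = 0; rw [map_smul, hy])
      exact ⟨0, t, fun a => by rw [ht]; simp⟩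
    | succ m ih =>
      intro p q r hq hp hr
      obtain ⟨s, t, hst⟩ := ih q r (r-1) (by push_cast at hq; omega) hr (by ring)
      have := F.proj q
      obtain ⟨t', ht'⟩ := lift_exact (dd F.X p q) (dd F.X q r) (F.ex p q r hp hr (by omega))
        (y • LinearMap.id - t ∘ₗ dd F.X q r) (fun a => by
          change dd F.X q r (y • a - t (dd F.X q r a)) = 0
          have h1 := hst (dd F.X q r a)
          rw [dd_dd, map_zero, zero_add] at h1
          rw [map_sub, map_smul, h1, sub_self])
      refine ⟨t, t', fun a => ?_⟩
      rw [ht']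
      change _ = _ + (y • a - t (dd F.X q r a))
      abel
  rcases lt_or_ge q 0 with h | h
  · exact nh_sub _ _ _ _ _ (F.zero q h)
  · exact main q.toNat _ _ _ (by omega) rfl (by ring)

theorem TAc.factor {X : CC R} (hX : TAc X) (p q r : ℤ) (hp : q + 1 = p) (hr : r + 1 = q)
    (N : Type) [AddCommGroup N] [Module R N] [Module.Finite R N] [Module.Projective R N]
    (φ : X.X q →ₗ[R] N) (h : ∀ a, φ (dd X p q a) = 0) :
    ∃ ψ : X.X r →ₗ[R] N, ∀ a, ψ (dd X q r a) = φ a := by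
  obtain ⟨m, f, g, hf, hg, hfg⟩ := Module.Finite.exists_comp_eq_id_of_projective R N
  choose ψ hψ using fun i : Fin m => hX.exd p q r hp hr ((LinearMap.proj i) ∘ₗ g ∘ₗ φ) (by
    ext a
    change g (φ (dd X p q a)) i = 0
    rw [h, map_zero]; rfl)
  refine ⟨f ∘ₗ LinearMap.pi ψ, fun a => ?_⟩
  have : LinearMap.pi ψ (dd X q r a) = g (φ a) := by
    ext i
    exact LinearMap.congr_fun (hψ i) a
  change f (LinearMap.pi ψ (dd X q r a)) = _
  rw [this]
  exact LinearMap.congr_fun hfg _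

theorem TAc.nh {T P : CC R} (hT : TAc T) {n₀ : ℤ} (c : Cmp T P n₀) (y : R)
    (hP : ∀ q, NH P (q+1) q (q-1) y) (q : ℤ) : NH T (q+1) q (q-1) y := by
  have top : ∀ p q r, q + 1 = p → r + 1 = q → n₀ < q → NH T p q r y := by
    intro p q r hp hr hq
    subst hp
    obtain rfl : r = q - 1 := by omega
    obtain ⟨s, t, hst⟩ := hP q
    have h1 : n₀ ≤ q := by omega
    have h2 : n₀ ≤ q + 1 := by omega
    have h3 : n₀ ≤ q - 1 := by omega
    refine ⟨(c.e q h1).symm.toLinearMap ∘ₗ s ∘ₗ (c.e (q-1) h3).toLinearMap,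
      (c.e (q+1) h2).symm.toLinearMap ∘ₗ t ∘ₗ (c.e q h1).toLinearMap, fun a => ?_⟩
    apply (c.e q h1).injective
    rw [map_add, c.comm _ _ h2 h1, map_smul, hst]
    simp [c.comm _ _ h1 h3]
  have down : ∀ (m : ℕ) (p q r : ℤ), q + 1 = p → r + 1 = q → n₀ < q + m → NH T p q r y := by
    intro m
    induction m with
    | zero => intro p q r hp hr hq; exact top p q r hp hr (by simpa using hq)
    | succ m ih =>
      intro p q r hp hr hq
      obtain ⟨s, t, hst⟩ := ih (p+1) p q rfl hp (by push_cast at hq; omega)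
      have := hT.fg q
      have := hT.proj q
      obtain ⟨s', hs'⟩ := hT.factor p q r hp hr (T.X q) (y • LinearMap.id - dd T p q ∘ₗ s)
        (fun a => by
          change y • dd T p q a - dd T p q (s (dd T p q a)) = 0
          have h1 := congrArg (dd T p q) (hst a)
          rw [map_add, dd_dd, add_zero, map_smul] at h1
          rw [h1, sub_self])
      refine ⟨s', s, fun a => ?_⟩
      rw [hs']
      change _ = (y • a - dd T p q (s a)) + _
      abel
  exact down (n₀ - q + 1).toNat _ _ _ rfl (by ring) (by omega)

section
variable {A B C A' B' C' : Type} [AddCommGroup A] [Module R A]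
  [AddCommGroup B] [Module R B] [AddCommGroup C] [Module R C] [AddCommGroup A'] [Module R A']
  [AddCommGroup B'] [Module R B'] [AddCommGroup C'] [Module R C']

def hmCongr3 (f : A →ₗ[R] B) (g : B →ₗ[R] C) (f' : A' →ₗ[R] B') (g' : B' →ₗ[R] C')
    (eA : A ≃ₗ[R] A') (eB : B ≃ₗ[R] B') (eC : C ≃ₗ[R] C') (h1 : ∀ a, eB (f a) = f' (eA a))
    (h2 : ∀ a, eC (g a) = g' (eB a)) : Hm f g ≃ₗ[R] Hm f' g' :=
  hmCongr _ _ _ _ eB (fun b => by rw [← h2, map_eq_zero_iff _ eC.injective]) (fun b => by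
    constructor
    · rintro ⟨a, rfl⟩
      exact ⟨eA a, (h1 a).symm⟩
    · rintro ⟨a, ha⟩
      refine ⟨eA.symm a, eB.injective ?_⟩
      rw [h1, eA.apply_symm_apply, ha])
end

variable {N : Type} [AddCommGroup N] [Module R N]

def Cmp.ht {T P : CC R} {n₀ : ℤ} (c : Cmp T P n₀) (N : Type) [AddCommGroup N] [Module R N] (q : ℤ)
    (hq : n₀ < q) : HT T N q ≃ₗ[R] HT P N q :=
  eT (htEquiv T N (q+1) q (q-1) rfl (by ring)) (eT
    (hmCongr3 _ _ _ _ (TensorProduct.congr (c.e (q+1) (by omega)) (LinearEquiv.refl R N))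
      (TensorProduct.congr (c.e q (by omega)) (LinearEquiv.refl R N))
      (TensorProduct.congr (c.e (q-1) (by omega)) (LinearEquiv.refl R N))
      (fun a => by
        induction a with
        | zero => simp
        | add a b ha hb => simp only [map_add, ha, hb]
        | tmul a n => simp [c.comm (q+1) q (by omega) (by omega)])
      (fun a => by
        induction a with
        | zero => simp
        | add a b ha hb => simp only [map_add, ha, hb]
        | tmul a n => simp [c.comm q (q-1) (by omega) (by omega)]))
    (htEquiv P N (q+1) q (q-1) rfl (by ring)).symm)

def Cmp.he {T P : CC R} {n₀ : ℤ} (c : Cmp T P n₀) (N : Type) [AddCommGroup N] [Module R N] (q : ℤ)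
    (hq : n₀ < q) : HE P N q ≃ₗ[R] HE T N q :=
  eT (heEquiv P N (q+1) q (q-1) rfl (by ring)) (eT
    (hmCongr3 _ _ _ _ (LinearEquiv.congrLeft N R (c.e (q-1) (by omega)).symm)
      (LinearEquiv.congrLeft N R (c.e q (by omega)).symm)
      (LinearEquiv.congrLeft N R (c.e (q+1) (by omega)).symm)
      (fun a => by
        ext x
        change a (dd P q (q-1) (c.e q (by omega) x)) = a (c.e (q-1) (by omega) (dd T q (q-1) x))
        rw [c.comm q (q-1) (by omega) (by omega)])
      (fun a => by
        ext x
        change a (dd P (q+1) q (c.e (q+1) (by omega) x)) = a (c.e q (by omega) (dd T (q+1) q x))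
        rw [c.comm (q+1) q (by omega) (by omega)]))
    (heEquiv T N (q+1) q (q-1) rfl (by ring)).symm)

theorem hm_sub_mid {A B C : Type} [AddCommGroup A] [Module R A]
  [AddCommGroup B] [Module R B] [AddCommGroup C] [Module R C] (f : A →ₗ[R] B) (g : B →ₗ[R] C)
  (h : Subsingleton B) : Subsingleton (Hm f g) :=
  hm_subsingleton (fun b _ => by rw [Subsingleton.elim b 0]; exact Submodule.zero_mem _)

theorem ht_sub (X : CC R) (N : Type) [AddCommGroup N] [Module R N] (q : ℤ)
    (h : Subsingleton (X.X q)) : Subsingleton (HT X N q) := by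
  have : Subsingleton (X.X q ⊗[R] N) := by
    refine subsingleton_of_forall_eq 0 (fun z => ?_)
    induction z with
    | zero => rfl
    | add a b ha hb => rw [ha, hb, add_zero]
    | tmul a n => rw [Subsingleton.elim a 0, TensorProduct.zero_tmul]
  have := hm_sub_mid (LinearMap.rTensor N (dd X (q+1) q)) (LinearMap.rTensor N (dd X q (q-1))) this
  exact (htEquiv X N (q+1) q (q-1) rfl (by ring)).toEquiv.subsingleton

theorem he_sub (X : CC R) (N : Type) [AddCommGroup N] [Module R N] (q : ℤ)
    (h : Subsingleton (X.X q)) : Subsingleton (HE X N q) := by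
  have : Subsingleton (X.X q →ₗ[R] N) := 
    ⟨fun f g => by ext a; rw [Subsingleton.elim a 0, map_zero, map_zero]⟩
  have := hm_sub_mid (LinearMap.lcomp R N (dd X q (q-1))) (LinearMap.lcomp R N (dd X (q+1) q)) this
  exact (heEquiv X N (q+1) q (q-1) rfl (by ring)).toEquiv.subsingleton

variable [IsLocalRing R] [IsNoetherianRing R]

theorem res_kill (y : R) (hy : y ∈ IsLocalRing.maximalIdeal R) (a : IsLocalRing.ResidueField R) :
    y • a = 0 := by
  rw [Algebra.smul_def]
  have : algebraMap R (IsLocalRing.ResidueField R) y = 0 := (IsLocalRing.residue_eq_zero_iff y).2 hy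
  rw [this, zero_mul]

theorem FRes.he_ht (F : FRes R (IsLocalRing.ResidueField R)) (n : ℕ) (S : Type) [CommRing S]
    [Algebra R S] (r : ℕ) (hs : Function.Surjective (algebraMap R S)) (hl : IsLocalRing S)
    (hN : IsNoetherianRing S) (hd : ringKrullDim S = n) (hi : IDLT S S r) (q : ℤ) :
    Module.length R (HE F.X S (n + q)) = Module.length R (HT F.X S q) := by
  refine GorBetti.he_ht F.X F.fg F.proj (fun y hy q => F.nh y (res_kill y hy) q) ?_ n S r hs hl
    hN hd hi q
  intro S _ _ n
  refine ⟨-n-1, fun _ _ _ _ _ _ => ?_⟩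
  have h1 := ht_sub F.X S (-n-1) (F.zero _ (by omega))
  have h2 := he_sub F.X S (n + (-n-1)) (F.zero _ (by omega))
  rw [Module.length_eq_zero_iff.2 h1, Module.length_eq_zero_iff.2 h2]

theorem TAc.he_ht {T : CC R} (hT : TAc T) (F : FRes R (IsLocalRing.ResidueField R)) {n₀ : ℤ}
    (c : Cmp T F.X n₀) (n : ℕ) (S : Type) [CommRing S]
    [Algebra R S] (r : ℕ) (hs : Function.Surjective (algebraMap R S)) (hl : IsLocalRing S)
    (hN : IsNoetherianRing S) (hd : ringKrullDim S = n) (hi : IDLT S S r) (q : ℤ) :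
    Module.length R (HE T S (n + q)) = Module.length R (HT T S q) := by
  refine GorBetti.he_ht T hT.fg hT.proj
    (fun y hy q => hT.nh c y (F.nh y (res_kill y hy)) q) ?_ n S r hs hl hN hd hi q
  intro S _ _ n
  refine ⟨max 0 (n₀+1), fun r a1 a2 a3 a4 a5 => ?_⟩
  rw [(c.ht S _ (by omega)).length_eq, ← (c.he S _ (by omega)).length_eq]
  exact F.he_ht n S r a1 a2 a3 a4 a5 _

end
end GorBetti

namespace GorBetti
open scoped TensorProduct


section
variable {R : Type} [CommRing R]

theorem ht_exact_zero (X : CC R) (N : Type) [AddCommGroup N] [Module R N] [Module.Flat R N]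
    (p q r : ℤ) (hp : q + 1 = p) (hr : r + 1 = q) (h : Function.Exact (dd X p q) (dd X q r)) :
    Subsingleton (HT X N q) := by
  have : Subsingleton (Hm (LinearMap.rTensor N (dd X p q)) (LinearMap.rTensor N (dd X q r))) :=
    hm_subsingleton (fun b hb => (Module.Flat.rTensor_exact N h b).1 hb)
  exact (htEquiv X N p q r hp hr).toEquiv.subsingleton

theorem les_shift {ι : Type} {c : ComplexShape ι}
    (S : ShortComplex (HomologicalComplex (ModuleCat.{0} R) c)) (hS : S.ShortExact) (i j : ι)
    (hij : c.Rel i j) (hi : Subsingleton (S.X₂.homology i)) (hj : Subsingleton (S.X₂.homology j)) :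
    Module.length R (S.X₃.homology i) = Module.length R (S.X₁.homology j) := by
  have e1 := hS.homology_exact₁ i j hij
  have e3 := hS.homology_exact₃ i j hij
  have z1 : HomologicalComplex.homologyMap S.f j = 0 := by
    ext x; exact Subsingleton.elim _ _
  have z2 : HomologicalComplex.homologyMap S.g i = 0 := by
    ext x
    rw [Subsingleton.elim x 0, map_zero, map_zero]
  have m : Function.Injective (hS.δ i j hij).hom := by
    rw [← ModuleCat.mono_iff_injective]
    exact (ShortComplex.exact_iff_mono _ z2).1 e3
  have e : Function.Surjective (hS.δ i j hij).hom := by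
    rw [← ModuleCat.epi_iff_surjective]
    exact (ShortComplex.exact_iff_epi _ z1).1 e1
  exact (LinearEquiv.ofBijective _ ⟨m, e⟩).length_eq

variable {N N' L Y K : Type} [AddCommGroup N] [Module R N] [AddCommGroup N'] [Module R N']
  [AddCommGroup L] [Module R L] [AddCommGroup Y] [Module R Y] [AddCommGroup K] [Module R K]

theorem ht_congr (X : CC R) (e : N ≃ₗ[R] N') (q : ℤ) :
    Module.length R (HT X N q) = Module.length R (HT X N' q) := by
  rw [(htEquiv X N (q+1) q (q-1) rfl (by ring)).length_eq,
    (htEquiv X N' (q+1) q (q-1) rfl (by ring)).length_eq]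
  refine (hmCongr3 _ _ _ _ (TensorProduct.congr (LinearEquiv.refl R _) e)
    (TensorProduct.congr (LinearEquiv.refl R _) e) (TensorProduct.congr (LinearEquiv.refl R _) e)
    ?_ ?_).length_eq
  · intro a
    induction a with
    | zero => simp
    | add a b ha hb => simp only [map_add, ha, hb]
    | tmul a n => simp
  · intro a
    induction a with
    | zero => simp
    | add a b ha hb => simp only [map_add, ha, hb]
    | tmul a n => simp

theorem ht_shift (X : CC R) (hX : ∀ i, Module.Projective R (X.X i)) [Module.Flat R Y]
    (f : L →ₗ[R] Y) (g : Y →ₗ[R] K) (hf : Function.Injective f) (hg : Function.Surjective g)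
    (hex : Function.Exact f g) (q r : ℤ) (hr : r + 1 = q)
    (eq : Function.Exact (dd X (q+1) q) (dd X q r))
    (er : Function.Exact (dd X q r) (dd X r (r-1))) :
    Module.length R (HT X K q) = Module.length R (HT X L r) := by
  have w : tcMap X (ModuleCat.ofHom f) ≫ tcMap X (ModuleCat.ofHom g) = 0 := by
    refine HomologicalComplex.hom_ext _ _ (fun i => ModuleCat.hom_ext
      (TensorProduct.ext' fun a n => ?_))
    change a ⊗ₜ[R] (g (f n)) = 0
    rw [hex.apply_apply_eq_zero, TensorProduct.tmul_zero]
  let S : ShortComplex (CC R) := ShortComplex.mk _ _ w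
  have hS : S.ShortExact := by
    rw [HomologicalComplex.shortExact_iff_degreewise_shortExact]
    intro i
    have : Module.Projective R (X.X i) := hX i
    exact ses_of (LinearMap.lTensor (X.X i) f) (LinearMap.lTensor (X.X i) g)
      (Module.Flat.lTensor_preserves_injective_linearMap f hf) (LinearMap.lTensor_surjective _ hg)
      (lTensor_exact _ hex hg)
  exact les_shift S hS q r (by simpa using hr)
    (ht_exact_zero X Y (q+1) q r rfl hr eq) (ht_exact_zero X Y q r (r-1) hr (by ring) er)

section
variable {X2 X1 X0 Y1 Y0 : Type} [AddCommGroup X2] [Module R X2] [AddCommGroup X1] [Module R X1]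
  [AddCommGroup X0] [Module R X0] [AddCommGroup Y1] [Module R Y1] [AddCommGroup Y0] [Module R Y0]

abbrev UU (g : X1 →ₗ[R] X0) (ρ : Y1 →ₗ[R] Y0) : Submodule R (X0 ⊗[R] Y0) :=
  LinearMap.range (LinearMap.rTensor Y0 g) ⊓ LinearMap.range (LinearMap.lTensor X0 ρ)

abbrev VV (g : X1 →ₗ[R] X0) (ρ : Y1 →ₗ[R] Y0) : Submodule R (X0 ⊗[R] Y0) :=
  LinearMap.range (TensorProduct.map g ρ)

/-- the symmetric description of `Tor_1` -/
abbrev UV (g : X1 →ₗ[R] X0) (ρ : Y1 →ₗ[R] Y0) : Type :=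
  UU g ρ ⧸ (VV g ρ).submoduleOf (UU g ρ)

theorem uv_symm (g : X1 →ₗ[R] X0) (ρ : Y1 →ₗ[R] Y0) :
    Nonempty (UV g ρ ≃ₗ[R] UV ρ g) := by
  let e := TensorProduct.comm R X0 Y0
  have c1 : ∀ z, e (LinearMap.rTensor Y0 g z) =
      LinearMap.lTensor Y0 g (TensorProduct.comm R X1 Y0 z) := by
    intro z
    induction z with
    | zero => simp
    | add a b ha hb => simp only [map_add, ha, hb]
    | tmul a n => rfl
  have c2 : ∀ z, e (LinearMap.lTensor X0 ρ z) =
      LinearMap.rTensor X0 ρ (TensorProduct.comm R X0 Y1 z) := by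
    intro z
    induction z with
    | zero => simp
    | add a b ha hb => simp only [map_add, ha, hb]
    | tmul a n => rfl
  have c3 : ∀ z, e (TensorProduct.map g ρ z) =
      TensorProduct.map ρ g (TensorProduct.comm R X1 Y1 z) := by
    intro z
    induction z with
    | zero => simp
    | add a b ha hb => simp only [map_add, ha, hb]
    | tmul a n => rfl
  have r1 : ∀ b, b ∈ LinearMap.range (LinearMap.rTensor Y0 g) ↔
      e b ∈ LinearMap.range (LinearMap.lTensor Y0 g) := by
    intro b
    constructor
    · rintro ⟨z, rfl⟩; exact ⟨_, (c1 z).symm⟩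
    · rintro ⟨z, hz⟩
      refine ⟨(TensorProduct.comm R X1 Y0).symm z, e.injective ?_⟩
      rw [c1, LinearEquiv.apply_symm_apply, hz]
  have r2 : ∀ b, b ∈ LinearMap.range (LinearMap.lTensor X0 ρ) ↔
      e b ∈ LinearMap.range (LinearMap.rTensor X0 ρ) := by
    intro b
    constructor
    · rintro ⟨z, rfl⟩; exact ⟨_, (c2 z).symm⟩
    · rintro ⟨z, hz⟩
      refine ⟨(TensorProduct.comm R X0 Y1).symm z, e.injective ?_⟩
      rw [c2, LinearEquiv.apply_symm_apply, hz]
  have r3 : ∀ b, b ∈ VV g ρ ↔ e b ∈ VV ρ g := by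
    intro b
    constructor
    · rintro ⟨z, rfl⟩; exact ⟨_, (c3 z).symm⟩
    · rintro ⟨z, hz⟩
      refine ⟨(TensorProduct.comm R X1 Y1).symm z, e.injective ?_⟩
      rw [c3, LinearEquiv.apply_symm_apply, hz]
  have h1 : Submodule.map e.toLinearMap (UU g ρ) = UU ρ g := by
    ext b
    obtain ⟨b, rfl⟩ := e.surjective b
    constructor
    · rintro ⟨b', hb', hbe⟩
      rw [← hbe]
      exact ⟨(r2 b').1 hb'.2, (r1 b').1 hb'.1⟩
    · intro hb
      exact ⟨b, ⟨(r1 b).2 hb.2, (r2 b).2 hb.1⟩, rfl⟩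
  let e1 : UU g ρ ≃ₗ[R] UU ρ g := e.ofSubmodules _ _ h1
  refine ⟨Submodule.Quotient.equiv _ _ e1 ?_⟩
  ext b
  constructor
  · rintro ⟨b, hb, rfl⟩
    exact (r3 b.1).1 hb
  · intro hb
    refine ⟨e1.symm b, (r3 _).2 ?_, by simp⟩
    have : e (e1.symm b).1 = b.1 := congrArg Subtype.val (e1.apply_symm_apply b)
    change e (e1.symm b).1 ∈ VV ρ g
    rw [this]; exact hb

theorem hm_uv [Module.Flat R Y0] (f : X2 →ₗ[R] X1) (g : X1 →ₗ[R] X0) (ρ : Y1 →ₗ[R] Y0)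
    (π : Y0 →ₗ[R] L) (hfg : Function.Exact f g) (hρ : Function.Exact ρ π)
    (hπ : Function.Surjective π) :
    Nonempty (Hm (LinearMap.rTensor L f) (LinearMap.rTensor L g) ≃ₗ[R] UV g ρ) := by
  let Z : Submodule R (X1 ⊗[R] Y0) :=
    Submodule.comap (LinearMap.rTensor Y0 g) (LinearMap.range (LinearMap.lTensor X0 ρ))
  have sw : ∀ z, LinearMap.lTensor X0 π (LinearMap.rTensor Y0 g z) =
      LinearMap.rTensor L g (LinearMap.lTensor X1 π z) := by
    intro z
    rw [← LinearMap.comp_apply, ← LinearMap.comp_apply, LinearMap.lTensor_comp_rTensor,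
      LinearMap.rTensor_comp_lTensor]
  have sw' : ∀ z, LinearMap.lTensor X1 π (LinearMap.rTensor Y0 f z) =
      LinearMap.rTensor L f (LinearMap.lTensor X2 π z) := by
    intro z
    rw [← LinearMap.comp_apply, ← LinearMap.comp_apply, LinearMap.lTensor_comp_rTensor,
      LinearMap.rTensor_comp_lTensor]
  have sw2 : ∀ z, LinearMap.rTensor Y0 g (LinearMap.lTensor X1 ρ z) = TensorProduct.map g ρ z := by
    intro z
    rw [← LinearMap.comp_apply, LinearMap.rTensor_comp_lTensor]
  have ex0 := lTensor_exact X0 hρ hπ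
  have ex1 := lTensor_exact X1 hρ hπ
  have exf := Module.Flat.rTensor_exact Y0 hfg
  let α0 : Z →ₗ[R] LinearMap.ker (LinearMap.rTensor L g) :=
    ((LinearMap.lTensor X1 π) ∘ₗ Z.subtype).codRestrict _ (fun z => by
      change LinearMap.rTensor L g (LinearMap.lTensor X1 π z.1) = 0
      rw [← sw]
      exact (ex0 _).2 z.2)
  let α : Z →ₗ[R] Hm (LinearMap.rTensor L f) (LinearMap.rTensor L g) := Submodule.mkQ _ ∘ₗ α0
  let β0 : Z →ₗ[R] UU g ρ :=
    ((LinearMap.rTensor Y0 g) ∘ₗ Z.subtype).codRestrict _ (fun z => ⟨⟨z.1, rfl⟩, z.2⟩)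
  let β : Z →ₗ[R] UV g ρ := Submodule.mkQ _ ∘ₗ β0
  have hα : Function.Surjective α := by
    refine (Submodule.mkQ_surjective _).comp ?_
    rintro ⟨w, hw⟩
    obtain ⟨z, rfl⟩ := LinearMap.lTensor_surjective X1 hπ w
    refine ⟨⟨z, ?_⟩, rfl⟩
    refine (ex0 _).1 ?_
    rw [sw]; exact hw
  have hβ : Function.Surjective β := by
    refine (Submodule.mkQ_surjective _).comp ?_
    rintro ⟨w, ⟨z, rfl⟩, hw⟩
    exact ⟨⟨z, hw⟩, rfl⟩
  have hker : LinearMap.ker α = LinearMap.ker β := by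
    ext ⟨z, hz⟩
    have a1 : (⟨z, hz⟩ : Z) ∈ LinearMap.ker α ↔
        LinearMap.lTensor X1 π z ∈ LinearMap.range (LinearMap.rTensor L f) := by
      rw [LinearMap.mem_ker]
      exact Submodule.Quotient.mk_eq_zero _
    have b1 : (⟨z, hz⟩ : Z) ∈ LinearMap.ker β ↔ LinearMap.rTensor Y0 g z ∈ VV g ρ := by
      rw [LinearMap.mem_ker]
      exact Submodule.Quotient.mk_eq_zero _
    rw [a1, b1]
    constructor
    · rintro ⟨w, hw⟩
      obtain ⟨w, rfl⟩ := LinearMap.lTensor_surjective X2 hπ w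
      rw [← sw'] at hw
      obtain ⟨v, hv⟩ := (ex1 (z - LinearMap.rTensor Y0 f w)).1 (by rw [map_sub, hw, sub_self])
      refine ⟨v, ?_⟩
      rw [← sw2, hv, map_sub, exf.apply_apply_eq_zero, sub_zero]
    · rintro ⟨v, hv⟩
      rw [← sw2] at hv
      obtain ⟨w, hw⟩ := (exf (z - LinearMap.lTensor X1 ρ v)).1 (by rw [map_sub, hv, sub_self])
      refine ⟨LinearMap.lTensor X2 π w, ?_⟩
      rw [← sw', hw, map_sub, ex1.apply_apply_eq_zero, sub_zero]
  exact ⟨eT (LinearMap.quotKerEquivOfSurjective α hα).symm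
    (eT (Submodule.quotEquivOfEq _ _ hker) (LinearMap.quotKerEquivOfSurjective β hβ))⟩

end

/-- balance for `Tor_1`. -/
theorem ht_bal (X Y : CC R) (hX : ∀ i, Module.Projective R (X.X i))
    (hY : ∀ i, Module.Projective R (Y.X i)) (a a1 b b1 : ℤ) (ha : a + 1 = a1) (hb : b + 1 = b1)
    (π : X.X a →ₗ[R] K) (π' : Y.X b →ₗ[R] L)
    (hπ : Function.Surjective π) (hπ' : Function.Surjective π')
    (eX : Function.Exact (dd X (a1+1) a1) (dd X a1 a))
    (eY : Function.Exact (dd Y (b1+1) b1) (dd Y b1 b))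
    (eK : Function.Exact (dd X a1 a) π) (eL : Function.Exact (dd Y b1 b) π') :
    Module.length R (HT X L a1) = Module.length R (HT Y K b1) := by
  have := hX a
  have := hY b
  obtain ⟨e1⟩ := hm_uv (dd X (a1+1) a1) (dd X a1 a) (dd Y b1 b) π' eX eL hπ'
  obtain ⟨e2⟩ := hm_uv (dd Y (b1+1) b1) (dd Y b1 b) (dd X a1 a) π eY eK hπ
  obtain ⟨e3⟩ := uv_symm (dd X a1 a) (dd Y b1 b)
  rw [(htEquiv X L (a1+1) a1 a rfl ha).length_eq, (htEquiv Y K (b1+1) b1 b rfl hb).length_eq,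
    e1.length_eq, e2.length_eq, e3.length_eq]

end
end GorBetti

namespace GorBetti
open scoped TensorProduct


section
variable {R : Type} [CommRing R]

/-- syzygies -/
abbrev LL (Y : CC R) (b c : ℤ) : Submodule R (Y.X c) := LinearMap.range (dd Y b c)

theorem exact_range {A B C : Type} [AddCommGroup A] [Module R A]
    [AddCommGroup B] [Module R B] [AddCommGroup C] [Module R C] {f : A →ₗ[R] B} {g : B →ₗ[R] C}
    (h : Function.Exact f g) : Function.Exact f g.rangeRestrict := by
  intro b
  rw [← h b]
  exact Subtype.ext_iff

theorem exact_subtype {A B C : Type} [AddCommGroup A] [Module R A]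
    [AddCommGroup B] [Module R B] [AddCommGroup C] [Module R C] {f : A →ₗ[R] B} {g : B →ₗ[R] C}
    (h : Function.Exact f g) : Function.Exact (LinearMap.range f).subtype g := by
  intro b
  rw [h b]
  constructor
  · rintro ⟨a, rfl⟩; exact ⟨⟨_, a, rfl⟩, rfl⟩
  · rintro ⟨⟨_, a, rfl⟩, rfl⟩; exact ⟨a, rfl⟩

/-- one step of dimension shifting -/
theorem ll_shift (X Y : CC R) (hX : ∀ i, Module.Projective R (X.X i))
    (hY : ∀ i, Module.Projective R (Y.X i)) (q r a b c : ℤ) (hr : r + 1 = q)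
    (eq : Function.Exact (dd X (q+1) q) (dd X q r))
    (er : Function.Exact (dd X q r) (dd X r (r-1)))
    (eY : Function.Exact (dd Y a b) (dd Y b c)) :
    Module.length R (HT X (LL Y b c) q) = Module.length R (HT X (LL Y a b) r) := by
  have := hY b
  exact ht_shift X hX (LL Y a b).subtype (dd Y b c).rangeRestrict Subtype.val_injective
    (LinearMap.surjective_rangeRestrict _) (exact_subtype (exact_range eY)) q r hr eq er

theorem FRes.shift0 {M : Type} [AddCommGroup M] [Module R M] (F : FRes R M) (X : CC R)
    (hX : ∀ i, Module.Projective R (X.X i)) (q r : ℤ) (hr : r + 1 = q)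
    (eq : Function.Exact (dd X (q+1) q) (dd X q r))
    (er : Function.Exact (dd X q r) (dd X r (r-1))) :
    Module.length R (HT X M q) = Module.length R (HT X (LL F.X 1 0) r) := by
  have := F.proj 0
  exact ht_shift X hX (LL F.X 1 0).subtype F.π Subtype.val_injective
    F.surj (exact_subtype F.ex0) q r hr eq er

/-- iterated shift along a resolution; `X` exact above `e`. -/
theorem FRes.shift {M : Type} [AddCommGroup M] [Module R M] (F : FRes R M) (X : CC R)
    (hX : ∀ i, Module.Projective R (X.X i)) (e : ℤ)
    (hex : ∀ p q r, q + 1 = p → r + 1 = q → e < q → Function.Exact (dd X p q) (dd X q r))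
    (s : ℕ) : ∀ (q t b c : ℤ), b = s + 1 → c = s → t + b = q → e < t →
    Module.length R (HT X M q) = Module.length R (HT X (LL F.X b c) t) := by
  induction s with
  | zero =>
    intro q t b c hb hc ht he
    obtain rfl : b = 1 := by simpa using hb
    obtain rfl : c = 0 := by simpa using hc
    exact F.shift0 X hX q t ht (hex _ _ _ rfl ht (by omega)) (hex _ _ _ ht (by ring) he)
  | succ s ih =>
    intro q t b c hb hc ht he
    push_cast at hb hc
    rw [ih q (t+1) c (c-1) (by omega) (by omega) (by omega) (by omega)]
    exact ll_shift X F.X hX F.proj (t+1) t b c (c-1) rfl (hex _ _ _ rfl rfl (by omega))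
      (hex _ _ _ rfl (by ring) he) (F.ex b c (c-1) (by omega) (by ring) (by omega))

theorem FRes.bal {M K : Type} [AddCommGroup M] [Module R M] [AddCommGroup K] [Module R K]
    (F : FRes R M) (G : FRes R K) (q : ℤ) (hq : 1 ≤ q) :
    Module.length R (HT F.X K q) = Module.length R (HT G.X M q) := by
  rcases eq_or_lt_of_le hq with rfl | h
  · exact ht_bal F.X G.X F.proj G.proj 0 1 0 1 rfl rfl F.π G.π F.surj G.surj
      (F.ex _ _ _ rfl rfl (by omega)) (G.ex _ _ _ rfl rfl (by omega)) F.ex0 G.ex0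
  · rw [G.shift F.X F.proj 0 F.ex (q-2).toNat q 1 (q-1) (q-2) (by omega) (by omega) (by ring)
      (by omega)]
    have e := G.ex q (q-1) (q-2) (by ring) (by ring) (by omega)
    exact ht_bal F.X G.X F.proj G.proj 0 1 (q-1) q rfl (by ring) F.π
      (dd G.X (q-1) (q-2)).rangeRestrict F.surj (LinearMap.surjective_rangeRestrict _)
      (F.ex _ _ _ rfl rfl (by omega)) (G.ex _ _ _ rfl (by ring) (by omega)) F.ex0 (exact_range e)

theorem TAc.shiftNat {X Y : CC R} (hX : TAc X) (hY : TAc Y) (m : ℕ) :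
    ∀ (a b c a' b' c' : ℤ), c + 1 = b → c' + 1 = b' → a = a' + m → b' = b + m →
      Module.length R (HT X (LL Y b c) a) = Module.length R (HT X (LL Y b' c') a') := by
  induction m with
  | zero =>
    intro a b c a' b' c' h1 h2 h3 h4
    obtain rfl : b' = b := by simpa using h4
    obtain rfl : a = a' := by simpa using h3
    obtain rfl : c = c' := by omega
    rfl
  | succ m ih =>
    intro a b c a' b' c' h1 h2 h3 h4
    push_cast at h3 h4
    rw [ih a b c (a'+1) c' (c'-1) h1 (by ring) (by omega) (by omega)]
    exact ll_shift X Y hX.proj hY.proj (a'+1) a' b' c' (c'-1) rfl (hX.ex _ _ _ rfl rfl)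
      (hX.ex _ _ _ rfl (by ring)) (hY.ex b' c' (c'-1) h2 (by ring))

theorem TAc.shift {X Y : CC R} (hX : TAc X) (hY : TAc Y) 
    (a b c a' b' c' : ℤ) (h1 : c + 1 = b) (h2 : c' + 1 = b') (h : a + b = a' + b') :
      Module.length R (HT X (LL Y b c) a) = Module.length R (HT X (LL Y b' c') a') := by
  rcases le_total a' a with h' | h'
  · exact hX.shiftNat hY (a - a').toNat a b c a' b' c' h1 h2 (by omega) (by omega)
  · exact (hX.shiftNat hY (a' - a).toNat a' b' c' a b c h2 h1 (by omega) (by omega)).symm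

def Cmp.ll {T P : CC R} {n₀ : ℤ} (h : Cmp T P n₀) (b c : ℤ) (hb : n₀ ≤ b) (hc : n₀ ≤ c) :
    LL T b c ≃ₗ[R] LL P b c :=
  (h.e c hc).ofSubmodules _ _ (by
    ext z
    constructor
    · rintro ⟨_, ⟨a, rfl⟩, rfl⟩
      exact ⟨h.e b hb a, (h.comm _ _ hb hc a).symm⟩
    · rintro ⟨a, rfl⟩
      refine ⟨dd T b c ((h.e b hb).symm a), ⟨_, rfl⟩, ?_⟩
      change h.e c hc _ = _
      rw [h.comm _ _ hb hc, LinearEquiv.apply_symm_apply])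

/-- Tate homology of a module is Tate homology of a syzygy in its complete resolution. -/
theorem TAc.syz {X : CC R} (hX : TAc X) {M : Type} [AddCommGroup M] [Module R M] (F : FRes R M)
    {T : CC R} (hT : TAc T) {n₀ : ℤ} (h : Cmp T F.X n₀) (q a b c : ℤ) (hc : c + 1 = b)
    (hq : a + b = q) :
    Module.length R (HT X M q) = Module.length R (HT X (LL T b c) a) := by
  let s : ℕ := n₀.toNat
  have hs : n₀ ≤ s := by omega
  rw [F.shift X hX.proj (q - s - 2) (fun p q r h1 h2 _ => hX.ex p q r h1 h2) s q (q - s - 1) (s+1) s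
    rfl rfl (by ring) (by omega)]
  rw [← ht_congr X (h.ll (s+1) s (by omega) hs)]
  exact hX.shift hT _ _ _ _ _ _ rfl hc (by omega)

theorem TAc.bal {M K : Type} [AddCommGroup M] [Module R M] [AddCommGroup K] [Module R K]
    {T T' : CC R} (hT : TAc T) (hT' : TAc T') (F : FRes R M) (G : FRes R K) {n₀ n₁ : ℤ}
    (h : Cmp T F.X n₀) (h' : Cmp T' G.X n₁) (q : ℤ) :
    Module.length R (HT T K q) = Module.length R (HT T' M q) := by
  rw [hT.syz G hT' h' q 1 (q-1) (q-2) (by ring) (by ring),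
    hT'.syz F hT h q q 0 (-1) (by ring) (by ring)]
  exact ht_bal T T' hT.proj hT'.proj 0 1 (q-1) q rfl (by ring) (dd T 0 (-1)).rangeRestrict
      (dd T' (q-1) (q-2)).rangeRestrict (LinearMap.surjective_rangeRestrict _)
      (LinearMap.surjective_rangeRestrict _)
      (hT.ex _ _ _ rfl rfl) (hT'.ex _ _ _ rfl (by ring)) (exact_range (hT.ex _ _ _ rfl rfl))
      (exact_range (hT'.ex _ _ _ (by ring) (by ring)))

end
end GorBetti

namespace GorBetti
open scoped TensorProduct


section
variable {R : Type} [CommRing R] {M : Type} [AddCommGroup M] [Module R M]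

theorem exactAt_dd (X : CC R) (p q r : ℤ) (hp : q + 1 = p) (hr : r + 1 = q) :
    X.ExactAt q ↔ Function.Exact (dd X p q) (dd X q r) :=
  exactAt_iff_hm X p q r (by subst hp; simp) (by subst hr; simp)

/-- the resolution underlying a complete resolution -/
def fresOf (C : CompleteResolution R (ModuleCat.of R M)) : FRes R M where
  X := C.P
  π := C.π.hom
  proj i := (IsProjective.iff_projective _).2 (C.projP i)
  fg := C.fgP
  zero i hi := ModuleCat.subsingleton_of_isZero (C.zeroP i hi)
  surj := (ModuleCat.epi_iff_surjective _).1 C.epiπ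
  ex0 := (ShortComplex.ShortExact.moduleCat_exact_iff_function_exact _).1 C.exact0
  ex p q r hp hr hq := (exactAt_dd C.P p q r hp hr).1 (C.exactP q hq)

theorem tacOf (C : CompleteResolution R (ModuleCat.of R M)) : TAc C.T where
  proj i := (IsProjective.iff_projective _).2 (C.projT i)
  fg := C.fgT
  ex p q r hp hr := (exactAt_dd C.T p q r hp hr).1 (C.exactT q)
  exd p q r hp hr φ hφ := by
    have := (exactAt_iff_hm (C.T.linearYonedaObj R (ModuleCat.of R R)) r q p
      (by subst hr; simp) (by subst hp; simp)).1 (C.exactTdual q)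
    obtain ⟨ψ, hψ⟩ := (this (ModuleCat.ofHom φ)).1 (by
      change (C.T.d p q ≫ ModuleCat.ofHom φ : C.T.X p ⟶ _) = 0
      ext1
      exact hφ)
    refine ⟨ModuleCat.Hom.hom ψ, ?_⟩
    exact congrArg ModuleCat.Hom.hom hψ

theorem cmpOf (C : CompleteResolution R (ModuleCat.of R M)) :
    ∃ n₀ : ℤ, Nonempty (Cmp C.T (fresOf C).X n₀) := by
  obtain ⟨n₀, h⟩ := C.iso_eventually
  refine ⟨n₀, ⟨{ e := fun i hi => ?_, comm := fun i j hi hj a => ?_}⟩⟩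
  · exact LinearEquiv.ofBijective (C.θ.f i).hom (by
      have := h i hi
      exact (ConcreteCategory.isIso_iff_bijective (C.θ.f i)).1 this)
  · change (C.θ.f j).hom ((C.T.d i j).hom a) = (C.P.d i j).hom ((C.θ.f i).hom a)
    have := C.θ.comm i j
    exact (congrArg (fun f => ModuleCat.Hom.hom f a) this).symm

end

section
variable {R : Type} [CommRing R] [IsLocalRing R] [IsNoetherianRing R]

theorem ht_kill_res (X : CC R) (q : ℤ) (y : R) (hy : y ∈ IsLocalRing.maximalIdeal R)
    (z : HT X (IsLocalRing.ResidueField R) q) : y • z = 0 := by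
  refine kill_congr (htEquiv X _ (q+1) q (q-1) rfl (by ring)) (hm_kill ?_) z
  intro b _
  have : y • b = 0 := by
    clear * - hy
    induction b with
    | zero => simp
    | add a b ha hb => rw [smul_add, ha, hb, add_zero]
    | tmul a n => rw [← TensorProduct.tmul_smul, res_kill y hy, TensorProduct.tmul_zero]
  rw [this]; exact Submodule.zero_mem _

theorem he_kill_res (X : CC R) (q : ℤ) (y : R) (hy : y ∈ IsLocalRing.maximalIdeal R)
    (z : HE X (IsLocalRing.ResidueField R) q) : y • z = 0 := by
  refine kill_congr (heEquiv X _ (q+1) q (q-1) rfl (by ring)) (hm_kill ?_) z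
  intro b _
  have : y • b = 0 := by
    ext a
    exact res_kill y hy _
  rw [this]; exact Submodule.zero_mem _

theorem he_eq_ht_res (X : CC R) (hX : ∀ i, Module.Finite R (X.X i)) (q : ℤ) :
    Module.length R (HE X (IsLocalRing.ResidueField R) q) =
      Module.length R (HT X (IsLocalRing.ResidueField R) q) := by
  have hinj : Module.Injective (IsLocalRing.ResidueField R) (IsLocalRing.ResidueField R) :=
    Module.injective_of_isSemisimpleRing _ _
  exact he_eq_ht X hX res_surj hinj ⟨1, one_ne_zero, fun y hy => res_kill y hy 1⟩ q
    (ht_kill_res X q)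

theorem part1 (S : Type) [CommRing S] [Algebra R S] (n r : ℕ)
    (hs : Function.Surjective (algebraMap R S)) (hl : IsLocalRing S)
    (hN : IsNoetherianRing S) (hd : ringKrullDim S = n) (hi : IDLT S S r)
    (C : CompleteResolution R (ModuleCat.of R S))
    (Ck : CompleteResolution R (ModuleCat.of R (IsLocalRing.ResidueField R))) (i : ℤ) :
    Nonempty (HE C.T (IsLocalRing.ResidueField R) i ≃ₗ[R] HE Ck.T S (n + i)) := by
  obtain ⟨n₀, ⟨c⟩⟩ := cmpOf C
  obtain ⟨n₁, ⟨ck⟩⟩ := cmpOf Ck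
  haveI : Module.Finite R S := Module.Finite.of_surjective (Algebra.linearMap R S) hs
  haveI : Module.Finite R (IsLocalRing.ResidueField R) :=
    Module.Finite.of_surjective (Algebra.linearMap R _) res_surj
  haveI := he_finite C.T C.fgT (IsLocalRing.ResidueField R) i
  haveI := he_finite Ck.T Ck.fgT S (n+i)
  refine equiv_of_length _ _ (he_kill_res C.T i) ?_ ?_
  · intro y hy z
    exact he_kill Ck.T S (n+i+1) (n+i) (n+i-1) rfl (by ring)
      ((tacOf Ck).nh ck y ((fresOf Ck).nh y (res_kill y hy)) _) z
  · rw [he_eq_ht_res C.T C.fgT, (tacOf Ck).he_ht (fresOf Ck) ck n S r hs hl hN hd hi]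
    exact (tacOf C).bal (tacOf Ck) (fresOf C) (fresOf Ck) c ck i

theorem part2 (S : Type) [CommRing S] [Algebra R S] (n r : ℕ)
    (hs : Function.Surjective (algebraMap R S)) (hl : IsLocalRing S)
    (hN : IsNoetherianRing S) (hd : ringKrullDim S = n) (hi : IDLT S S r)
    (F : FRes R S) (G : FRes R (IsLocalRing.ResidueField R)) (i : ℤ) (h1 : 1 ≤ i) :
    Nonempty (HE F.X (IsLocalRing.ResidueField R) i ≃ₗ[R] HE G.X S (n + i)) := by
  haveI : Module.Finite R S := Module.Finite.of_surjective (Algebra.linearMap R S) hs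
  haveI : Module.Finite R (IsLocalRing.ResidueField R) :=
    Module.Finite.of_surjective (Algebra.linearMap R _) res_surj
  haveI := he_finite F.X F.fg (IsLocalRing.ResidueField R) i
  haveI := he_finite G.X G.fg S (n+i)
  refine equiv_of_length _ _ (he_kill_res F.X i) ?_ ?_
  · intro y hy z
    exact he_kill G.X S (n+i+1) (n+i) (n+i-1) rfl (by ring) (G.nh y (res_kill y hy) _) z
  · rw [he_eq_ht_res F.X F.fg, G.he_ht n S r hs hl hN hd hi]
    exact F.bal G i h1

end

section
variable {R : Type} [CommRing R] [IsNoetherianRing R]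

theorem exists_cover (A : Type) [AddCommGroup A] [Module R A] (m : ℕ)
    (f : (Fin m → R) →ₗ[R] A) :
    ∃ (c : ℕ) (g : (Fin c → R) →ₗ[R] (Fin m → R)), Function.Exact g f := by
  obtain ⟨c, g, hg⟩ := Module.Finite.exists_fin' R (LinearMap.ker f)
  refine ⟨c, (LinearMap.ker f).subtype ∘ₗ g, ?_⟩
  rw [LinearMap.exact_iff, LinearMap.range_comp, LinearMap.range_eq_top.2 hg]
  simp

/-- a matrix map between free modules -/
structure FMap (R : Type) [CommRing R] where
  a : ℕ
  b : ℕ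
  f : (Fin a → R) →ₗ[R] (Fin b → R)

def FMap.next (s : FMap R) : FMap R :=
  ⟨(exists_cover _ _ s.f).choose, s.a, (exists_cover _ _ s.f).choose_spec.choose⟩

theorem FMap.next_exact (s : FMap R) : Function.Exact s.next.f s.f :=
  (exists_cover _ _ s.f).choose_spec.choose_spec

def FMap.seq (s : FMap R) : ℕ → FMap R
  | 0 => s
  | n+1 => (FMap.seq s n).next

def fX (s : FMap R) : ℤ → ModuleCat.{0} R
  | Int.ofNat n => ModuleCat.of R (Fin (s.seq n).b → R)
  | Int.negSucc _ => ModuleCat.of R PUnit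

def fd (s : FMap R) : ∀ n : ℤ, fX s (n+1) ⟶ fX s n
  | Int.ofNat n => ModuleCat.ofHom (s.seq n).f
  | Int.negSucc _ => 0

theorem fd_sq (s : FMap R) (n : ℤ) : fd s (n+1) ≫ fd s n = 0 := by
  rcases n with n | n
  · refine ModuleCat.hom_ext (LinearMap.ext fun x => ?_)
    exact (FMap.next_exact (s.seq n)).apply_apply_eq_zero x
  · exact comp_zero

def fC (s : FMap R) : CC R := ChainComplex.of (fX s) (fd s) (fd_sq s)

theorem fC_dd (s : FMap R) (n : ℤ) : dd (fC s) (n+1) n = (fd s n).hom := by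
  have : (fC s).d (n+1) n = fd s n := ChainComplex.of_d _ _ _
  exact congrArg ModuleCat.Hom.hom this

theorem exists_fres (M : Type) [AddCommGroup M] [Module R M] [Module.Finite R M] :
    Nonempty (FRes R M) := by
  obtain ⟨m, π, hπ⟩ := Module.Finite.exists_fin' R M
  obtain ⟨c, g, hg⟩ := exists_cover M m π
  let s : FMap R := ⟨c, m, g⟩
  refine ⟨{ X := fC s, π := π, proj := ?_, fg := ?_, zero := ?_, surj := hπ, ex0 := ?_, ex := ?_}⟩
  · rintro (n | n)
    · exact inferInstanceAs (Module.Projective R (Fin (s.seq n).b → R))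
    · exact inferInstanceAs (Module.Projective R PUnit)
  · rintro (n | n)
    · exact inferInstanceAs (Module.Finite R (Fin (s.seq n).b → R))
    · exact inferInstanceAs (Module.Finite R PUnit)
  · rintro (n | n) h
    · exact absurd h (by simp)
    · exact inferInstanceAs (Subsingleton PUnit)
  · have := fC_dd s 0
    change Function.Exact (dd (fC s) (0+1) 0) π
    rw [this]
    exact hg
  · rintro p q r rfl rfl h
    rw [fC_dd, fC_dd]
    rcases r with r | r
    · exact FMap.next_exact (s.seq r)
    · exact absurd h (by omega)

end

section
variable {R : Type} [CommRing R] {M : Type} [AddCommGroup M] [Module R M]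

/-- restriction to natural number indices -/
def FRes.nat (F : FRes R M) : ChainComplex (ModuleCat.{0} R) ℕ where
  X n := F.X.X n
  d i j := F.X.d i j
  shape i j h := F.X.shape _ _ (fun h' => h (by
    simp only [ComplexShape.down_Rel] at h' ⊢
    exact_mod_cast h'))
  d_comp_d' i j k _ _ := F.X.d_comp_d _ _ _

theorem nat_exact (F : FRes R M) (n : ℕ) :
    F.nat.ExactAt (n+1) := by
  rw [exactAt_iff_hm F.nat (n+2) (n+1) n (by simp) (by simp)]
  exact F.ex _ _ _ (by push_cast; ring) (by push_cast; ring) (by push_cast; omega)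

theorem FRes.w0 (F : FRes R M) : F.X.d 1 0 ≫ ModuleCat.ofHom F.π = 0 := by
  refine ModuleCat.hom_ext (LinearMap.ext fun x => ?_)
  exact F.ex0.apply_apply_eq_zero x

def FRes.sc (F : FRes R M) : ShortComplex (ModuleCat.{0} R) :=
  ShortComplex.mk (F.X.d 1 0) (ModuleCat.ofHom F.π) F.w0

theorem FRes.scExact (F : FRes R M) : F.sc.Exact :=
  (ShortComplex.ShortExact.moduleCat_exact_iff_function_exact _).2 F.ex0

def FRes.aug (F : FRes R M) : F.nat ⟶ (ChainComplex.single₀ (ModuleCat.{0} R)).obj (ModuleCat.of R M) :=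
  (ChainComplex.toSingle₀Equiv F.nat (ModuleCat.of R M)).symm ⟨ModuleCat.ofHom F.π, F.w0⟩

theorem FRes.aug_zero (F : FRes R M) : F.aug.f 0 = ModuleCat.ofHom F.π :=
  ChainComplex.toSingle₀Equiv_symm_apply_f_zero (C := F.nat) (X := ModuleCat.of R M)
    (ModuleCat.ofHom F.π) F.w0

def FRes.projRes (F : FRes R M) : ProjectiveResolution (ModuleCat.of R M) where
  complex := F.nat
  projective n := (IsProjective.iff_projective _).1 (F.proj n)
  π := F.aug
  quasiIso := ⟨fun n => by
    cases n
    · rw [ChainComplex.quasiIsoAt₀_iff, ShortComplex.quasiIso_iff_of_zeros']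
      · refine (ShortComplex.exact_and_epi_g_iff_of_iso ?_).2
          (⟨F.scExact, (ModuleCat.epi_iff_surjective _).2 F.surj⟩ :
            F.sc.Exact ∧ Epi F.sc.g)
        exact ShortComplex.isoMk (Iso.refl _) (Iso.refl _) (Iso.refl _) 
          ((Category.id_comp _).trans (Category.comp_id _).symm)
          ((Category.id_comp _).trans (Eq.trans
            F.aug_zero.symm (Category.comp_id _).symm))
      all_goals first | rfl | exact F.nat.shape _ _ (by simp)
    · rw [quasiIsoAt_iff_exactAt']
      · exact nat_exact F _
      · apply ChainComplex.exactAt_succ_single_obj⟩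

theorem FRes.ext_equiv (F : FRes R M) (N : Type) [AddCommGroup N] [Module R N] (i : ℕ)
    (hi : 1 ≤ i) :
    Nonempty (ExtMod R i (ModuleCat.of R M) (ModuleCat.of R N) ≃ₗ[R] HE F.X N i) := by
  obtain ⟨j, rfl⟩ : ∃ j, i = j + 1 := ⟨i-1, by omega⟩
  have e1 := (F.projRes.isoExt (R := R) (j+1) (ModuleCat.of R N)).toLinearEquiv
  have e2 := homologyEquiv (F.nat.linearYonedaObj R (ModuleCat.of R N)) j (j+1) (j+2)
    (by simp) (by simp)
  have e3 := homologyEquiv (F.X.linearYonedaObj R (ModuleCat.of R N)) j ((j+1:ℕ):ℤ) (j+2:ℕ)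
    (by simp) (by simp; ring)
  exact ⟨eT e1 (eT e2 e3.symm)⟩

end
end GorBetti

/-- Let `R` be a Gorenstein local ring and `a` a Gorenstein ideal of `R`, with
`n = dim(R/a)`. Then `β̂_i(R/a) = μ̂^{n+i}(R/a)` for all `i ∈ ℤ` (the corresponding Tate
cohomology modules with residue field coefficients are isomorphic). In particular,
`β_i(R/a) = μ^{n+i}(R/a)` for all `i > G-dim_R(R/a)`. -/
theorem stmt_7 (R : Type) [CommRing R] [IsLocalRing R] (hR : IsGorensteinLocalRing R)
    (a : Ideal R) (ha : IsGorensteinLocalRing (R ⧸ a))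
    (n : ℕ) (hn : ringKrullDim (R ⧸ a) = n) :
    (∀ (C : CompleteResolution R (ModuleCat.of R (R ⧸ a)))
      (Ck : CompleteResolution R (ModuleCat.of R (IsLocalRing.ResidueField R))) (i : ℤ),
      Nonempty
        ((TateExt R C (ModuleCat.of R (IsLocalRing.ResidueField R)) i) ≃ₗ[R]
          (TateExt R Ck (ModuleCat.of R (R ⧸ a)) ((n : ℤ) + i)))) ∧
    (∀ i : ℕ, gdim R (ModuleCat.of R (R ⧸ a)) < (i : ℕ∞) →
      Nonempty
        ((ExtMod R i (ModuleCat.of R (R ⧸ a))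
            (ModuleCat.of R (IsLocalRing.ResidueField R))) ≃ₗ[R]
          (ExtMod R (n + i) (ModuleCat.of R (IsLocalRing.ResidueField R))
            (ModuleCat.of R (R ⧸ a))))) := by
  have hNR : IsNoetherianRing R := hR.2.1
  obtain ⟨hl, hN, r, hr⟩ := ha
  have hi : GorBetti.IDLT (R ⧸ a) (R ⧸ a) (r + 2) :=
    GorBetti.hasInjDim_of_injDimLE _ _ _ hr
  have hs : Function.Surjective (algebraMap R (R ⧸ a)) := Ideal.Quotient.mk_surjective
  refine ⟨fun C Ck i => ?_, fun i hgi => ?_⟩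
  · exact GorBetti.part1 (R ⧸ a) n (r + 2) hs hl hN hn hi C Ck i
  · have h1 : 1 ≤ i := by
      rcases Nat.eq_zero_or_pos i with rfl | h
      · simp at hgi
      · exact h
    have : Module.Finite R (IsLocalRing.ResidueField R) :=
      Module.Finite.of_surjective (Algebra.linearMap R (IsLocalRing.ResidueField R))
        IsLocalRing.residue_surjective
    obtain ⟨F⟩ := GorBetti.exists_fres (R := R) (R ⧸ a)
    obtain ⟨G⟩ := GorBetti.exists_fres (R := R) (IsLocalRing.ResidueField R)
    obtain ⟨e1⟩ := F.ext_equiv (IsLocalRing.ResidueField R) i h1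
    obtain ⟨e2⟩ := GorBetti.part2 (R ⧸ a) n (r + 2) hs hl hN hn hi F G (i : ℤ)
      (by exact_mod_cast h1)
    obtain ⟨e3⟩ := G.ext_equiv (R ⧸ a) (n + i) (by omega)
    rw [Nat.cast_add] at e3
    exact ⟨e1.trans (e2.trans e3.symm)⟩

end
end

section
/- Let M and N be finitely generated R-modules over a local ring R with G-dim_R(M) < ∞, and assume that either M or N has reducible complexity. Then the following are equivalent: (i) Êxt^i_R(M,N) = 0 for all i ≫ 0; (ii) Êxt^i_R(M,N) = 0 for all i ≪ 0; (iii) Êxt^i_R(M,N) = 0 for all i ∈ ℤ. -/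
open CategoryTheory CategoryTheory.Limits CategoryTheory.MonoidalCategory Opposite

noncomputable section

universe u

variable (R : Type u) [CommRing R]

namespace TateRed

section General

variable {R : Type} [CommRing R]

/-- An abstract vanishing pattern for a cohomological functor on short exact sequences. -/
structure VanTh (V : ModuleCat.{0} R → ℤ → Prop) : Prop where
  mid : ∀ {S : ShortComplex (ModuleCat.{0} R)}, S.ShortExact → ∀ i, V S.X₁ i → V S.X₃ i → V S.X₂ i
  right : ∀ {S : ShortComplex (ModuleCat.{0} R)}, S.ShortExact →
    ∀ i, V S.X₂ i → V S.X₁ (i+1) → V S.X₃ i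
  left : ∀ {S : ShortComplex (ModuleCat.{0} R)}, S.ShortExact →
    ∀ i, V S.X₂ (i+1) → V S.X₃ i → V S.X₁ (i+1)
  proj : ∀ (P : ModuleCat.{0} R), Projective P → Module.Finite R P → ∀ i, V P i

lemma ses_of_linear {A B C : ModuleCat.{0} R} (f : A ⟶ B) (g : B ⟶ C)
    (hf : Function.Injective f.hom) (hg : Function.Surjective g.hom)
    (h : LinearMap.ker g.hom = LinearMap.range f.hom) :
    ∃ w : f ≫ g = 0, (ShortComplex.mk f g w).ShortExact := by
  have w : f ≫ g = 0 := by
    ext x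
    have : f.hom x ∈ LinearMap.ker g.hom := by rw [h]; exact ⟨x, rfl⟩
    simpa using this
  exact ⟨w, ModuleCat.shortComplex_shortExact _ (LinearMap.exact_iff.2 h) hf hg⟩

/-- the cokernel of a linear map -/
abbrev Qm {A B : Type} [AddCommGroup A] [Module R A] [AddCommGroup B] [Module R B]
    (d : A →ₗ[R] B) : ModuleCat.{0} R := ModuleCat.of R (B ⧸ LinearMap.range d)

lemma sesQ {A B C : Type} [AddCommGroup A] [Module R A] [AddCommGroup B] [Module R B]
    [AddCommGroup C] [Module R C] (d₁ : A →ₗ[R] B) (d₂ : B →ₗ[R] C)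
    (h : LinearMap.ker d₂ = LinearMap.range d₁) :
    ∃ w, (ShortComplex.mk (X₁ := Qm d₁) (X₂ := ModuleCat.of R C) (X₃ := Qm d₂)
      (ModuleCat.ofHom ((LinearMap.range d₁).liftQ d₂ h.ge))
      (ModuleCat.ofHom (LinearMap.range d₂).mkQ) w).ShortExact := by
  apply ses_of_linear
  · rw [← LinearMap.ker_eq_bot]
    simp only [ModuleCat.hom_ofHom]
    rw [Submodule.ker_liftQ, h, Submodule.mkQ_map_self]
  · exact Submodule.mkQ_surjective _
  · simp only [ModuleCat.hom_ofHom]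
    rw [Submodule.ker_mkQ, Submodule.range_liftQ]

def isoQ {A B C : Type} [AddCommGroup A] [Module R A] [AddCommGroup B] [Module R B]
    [AddCommGroup C] [Module R C] (d₁ : A →ₗ[R] B) (d₂ : B →ₗ[R] C)
    (h : LinearMap.ker d₂ = LinearMap.range d₁) (hs : Function.Surjective d₂) :
    Qm d₁ ≅ ModuleCat.of R C :=
  ((Submodule.quotEquivOfEq _ _ h.symm).trans
    (LinearMap.quotKerEquivOfSurjective d₂ hs)).toModuleIso

lemma ses_of_iso {A B : ModuleCat.{0} R} (e : A ≅ B) :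
    ∃ w, (ShortComplex.mk (0 : ModuleCat.of R PUnit.{1} ⟶ A) e.hom w).ShortExact := by
  apply ses_of_linear
  · intro x y _; exact Subsingleton.elim _ _
  · exact (e.toLinearEquiv).surjective
  · have := (e.toLinearEquiv).ker
    simp only [ModuleCat.hom_zero, LinearMap.range_zero]
    exact this

lemma VanTh.of_iso {V : ModuleCat.{0} R → ℤ → Prop} (hV : VanTh V) {A B : ModuleCat.{0} R}
    (e : A ≅ B) (i : ℤ) (h : V A i) : V B i := by
  obtain ⟨w, hS⟩ := ses_of_iso e
  refine hV.right hS i h (hV.proj _ ?_ ?_ _)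
  · exact (IsProjective.iff_projective (R := R) PUnit).1 inferInstance
  · change Module.Finite R PUnit; infer_instance

lemma exists_syz [IsNoetherianRing R] (X : ModuleCat.{0} R) (hX : Module.Finite R X) :
    ∃ (Y F : ModuleCat.{0} R) (f : Y ⟶ F) (g : F ⟶ X) (w : f ≫ g = 0),
      Module.Finite R Y ∧ Module.Finite R F ∧ Projective F ∧ (ShortComplex.mk f g w).ShortExact := by
  obtain ⟨n, φ, hφ⟩ := Module.Finite.exists_fin' R X
  obtain ⟨w, h⟩ := ses_of_linear (A := ModuleCat.of R (LinearMap.ker φ))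
    (B := ModuleCat.of R (Fin n → R)) (C := X) (ModuleCat.ofHom (LinearMap.ker φ).subtype)
    (ModuleCat.ofHom φ) Subtype.val_injective hφ (by simp)
  refine ⟨_, _, _, _, w, ?_, ?_, ?_, h⟩
  · change Module.Finite R (LinearMap.ker φ); infer_instance
  · change Module.Finite R (Fin n → R); infer_instance
  · exact (IsProjective.iff_projective (R := R) (Fin n → R)).1 inferInstance

lemma VanTh.of_pd [IsNoetherianRing R] {V : ModuleCat.{0} R → ℤ → Prop} (hV : VanTh V) (n : ℕ) :
    ∀ (X : ModuleCat.{0} R), Module.Finite R X → HasProjectiveDimensionLT X (n+1) →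
      ∀ i, V X i := by
  induction n with
  | zero =>
    intro X hX h i
    exact hV.proj X (projective_iff_hasProjectiveDimensionLT_one.2 h) hX i
  | succ n ih =>
    intro X hX h i
    obtain ⟨Y, F, f, g, w, hY, hF, hFp, hS⟩ := exists_syz X hX
    have := (hS.hasProjectiveDimensionLT_X₃_iff n hFp).1 h
    exact hV.right hS i (hV.proj F hFp hF i) (ih Y hY this _)

lemma chain_ker {G : ChainComplex (ModuleCat.{0} R) ℕ} (k : ℕ) (h : G.ExactAt (k+1)) :
    LinearMap.ker (G.d (k+1) k).hom = LinearMap.range (G.d (k+2) (k+1)).hom := by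
  rw [HomologicalComplex.exactAt_iff' _ (k+2) (k+1) k (by simp) (by simp),
    ShortComplex.moduleCat_exact_iff_range_eq_ker] at h
  exact h.symm

lemma pd_of_PdLE (M : ModuleCat.{0} R) (h : HasFinitePd R M) :
    ∃ n, HasProjectiveDimensionLT M (n+1) := by
  obtain ⟨n, G, ε, hp, hz, he, ⟨w, hw⟩, hex⟩ := h
  have key : ∀ k j, k + j = n + 1 →
      HasProjectiveDimensionLT (Qm (G.d (k+1) k).hom) (j+1) := by
    intro k j
    induction j generalizing k with
    | zero =>
      intro hk
      have : Subsingleton (G.X k) := ModuleCat.subsingleton_of_isZero (hz k (by omega))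
      have hZ : IsZero (Qm (G.d (k+1) k).hom) := by
        have : Subsingleton ((G.X k) ⧸ LinearMap.range (G.d (k+1) k).hom) := inferInstance
        exact ModuleCat.isZero_of_subsingleton _
      have := hZ.hasProjectiveDimensionLT_zero
      infer_instance
    | succ j ih =>
      intro hk
      obtain ⟨w', hS⟩ := sesQ _ _ (chain_ker k (hex (k+1) (by omega)))
      exact (hS.hasProjectiveDimensionLT_X₃_iff j (hp k)).2 (ih (k+1) (by omega))
  have h0 := key 0 (n+1) (by omega)
  rw [ShortComplex.moduleCat_exact_iff_range_eq_ker] at hw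
  exact ⟨n+1, @hasProjectiveDimensionLT_of_iso _ _ _ _ _ (isoQ (G.d 1 0).hom ε.hom hw.symm
    ((ModuleCat.epi_iff_surjective _).1 he)) _ h0⟩

lemma periodic_up {V : ℤ → Prop} (k : ℕ) (hk : 0 < k) (h : ∀ i, V (i + k) → V i) (n₀ : ℤ)
    (h₀ : ∀ i, n₀ ≤ i → V i) (i : ℤ) : V i := by
  have : ∀ m : ℕ, ∀ i, V (i + m * k) → V i := by
    intro m
    induction m with
    | zero => intro i hi; simpa using hi
    | succ m ih =>
      intro i hi
      refine h _ (ih _ ?_)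
      convert hi using 1; push_cast; ring
  refine this (n₀ - i).toNat i (h₀ _ ?_)
  have h1 : n₀ - i ≤ ((n₀ - i).toNat : ℤ) := Int.self_le_toNat _
  have h2 : ((n₀ - i).toNat : ℤ) ≤ ((n₀ - i).toNat : ℤ) * k :=
    le_mul_of_one_le_right (by positivity) (by exact_mod_cast hk)
  linarith

lemma step {V VK : ℤ → Prop} (j : ℕ)
    (h1 : ∀ i, V i → V (i - j) → VK i)
    (h2 : (∀ i, VK i) → ∀ i, V i ↔ V (i + (j + 1 : ℕ)))
    (ih1 : (∃ n₀ : ℤ, ∀ i, n₀ ≤ i → VK i) → ∀ i, VK i)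
    (ih2 : (∃ n₀ : ℤ, ∀ i, i ≤ n₀ → VK i) → ∀ i, VK i) :
    ((∃ n₀ : ℤ, ∀ i, n₀ ≤ i → V i) → ∀ i, V i) ∧
    ((∃ n₀ : ℤ, ∀ i, i ≤ n₀ → V i) → ∀ i, V i) := by
  constructor
  · rintro ⟨n₀, hn⟩
    have hK := ih1 ⟨n₀ + j, fun i hi => h1 i (hn _ (by omega)) (hn _ (by omega))⟩
    exact periodic_up (j+1) (by omega) (fun i => (h2 hK i).2) n₀ hn
  · rintro ⟨n₀, hn⟩
    have hK := ih2 ⟨n₀, fun i hi => h1 i (hn _ (by omega)) (hn _ (by omega))⟩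
    intro i
    have := periodic_up (V := fun i => V (-i)) (j+1) (by omega)
      (fun i hi => by
        have := (h2 hK (-(i + (j+1 : ℕ)))).1 hi
        convert this using 1; ring) (-n₀) (fun i hi => hn _ (by omega)) (-i)
    simpa using this

variable [IsLocalRing R]

lemma VanTh.omega {V : ModuleCat.{0} R → ℤ → Prop} (hV : VanTh V) {M : Type} [AddCommGroup M]
    [Module R M] (F : MinFreeRes R M) (j : ℕ) (i : ℤ) :
    V (Qm (F.d j)) i ↔ V (ModuleCat.of R M) (i - j) := by
  induction j generalizing i with
  | zero =>
    have e := isoQ (F.d 0) F.aug F.exact_zero F.aug_surj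
    simp only [Nat.cast_zero, sub_zero]
    exact ⟨hV.of_iso e i, hV.of_iso e.symm i⟩
  | succ j ih =>
    obtain ⟨w, hS⟩ := sesQ _ _ (F.exact_succ j)
    have hF : ∀ i, V (ModuleCat.of R (Fin (F.b j) → R)) i := by
      refine hV.proj _ ((IsProjective.iff_projective (R := R) (Fin (F.b j) → R)).1 inferInstance) ?_
      change Module.Finite R (Fin (F.b j) → R); infer_instance
    have : i - ((j+1 : ℕ) : ℤ) = (i - 1) - j := by push_cast; ring
    rw [this, ← ih]
    obtain ⟨i, rfl⟩ : ∃ i', i = i' + 1 := ⟨i - 1, by ring⟩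
    rw [add_sub_cancel_right]
    exact ⟨fun h => hV.right hS i (hF _) h, fun h => hV.left hS i (hF _) h⟩

lemma sesK {M : Type} [AddCommGroup M]
    [Module R M] (F : MinFreeRes R M) (j : ℕ) (f : LinearMap.range (F.d j) →ₗ[R] M) :
    ∃ (a : ModuleCat.of R M ⟶ ModuleCat.of R (PushoutMod R F j f))
      (b : ModuleCat.of R (PushoutMod R F j f) ⟶ Qm (F.d j)) (w : a ≫ b = 0),
      (ShortComplex.mk a b w).ShortExact := by
  set I := LinearMap.range (LinearMap.prod f (-(LinearMap.range (F.d j)).subtype)) with hI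
  let a : M →ₗ[R] (M × (Fin (F.b j) → R)) ⧸ I := I.mkQ ∘ₗ LinearMap.inl R _ _
  have hle : I ≤ LinearMap.ker ((LinearMap.range (F.d j)).mkQ ∘ₗ
      LinearMap.snd R M (Fin (F.b j) → R)) := by
    rintro _ ⟨x, rfl⟩
    simp
  let b : ((M × (Fin (F.b j) → R)) ⧸ I) →ₗ[R] ((Fin (F.b j) → R) ⧸ LinearMap.range (F.d j)) :=
    I.liftQ _ hle
  refine ⟨ModuleCat.ofHom a, ModuleCat.ofHom b, ?_⟩
  apply ses_of_linear
  · rw [← LinearMap.ker_eq_bot]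
    refine (Submodule.eq_bot_iff _).2 fun m hm => ?_
    have hm' : I.mkQ (m, 0) = 0 := hm
    rw [Submodule.mkQ_apply, Submodule.Quotient.mk_eq_zero] at hm'
    obtain ⟨x, hx⟩ := hm'
    replace hx : (f x, (-(LinearMap.range (F.d j)).subtype) x) = (m, 0) := hx
    rw [Prod.mk.injEq] at hx
    have : x = 0 := by
      apply Subtype.ext
      simpa using hx.2
    rw [← hx.1, this, map_zero]
  · intro y
    obtain ⟨y, rfl⟩ := Submodule.mkQ_surjective _ y
    exact ⟨I.mkQ (0, y), rfl⟩
  · apply le_antisymm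
    · intro y hy
      obtain ⟨⟨m, y⟩, rfl⟩ := Submodule.mkQ_surjective _ y
      have hy' : (LinearMap.range (F.d j)).mkQ y = 0 := hy
      rw [Submodule.mkQ_apply, Submodule.Quotient.mk_eq_zero] at hy'
      refine ⟨m + f ⟨y, hy'⟩, ?_⟩
      change I.mkQ (m + f ⟨y, hy'⟩, 0) = I.mkQ (m, y)
      rw [← sub_eq_zero, ← map_sub, Submodule.mkQ_apply, Submodule.Quotient.mk_eq_zero]
      exact ⟨⟨y, hy'⟩, by simp⟩
    · rintro _ ⟨m, rfl⟩
      change (LinearMap.range (F.d j)).mkQ 0 = 0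
      exact map_zero _

lemma VanTh.main [IsNoetherianRing R] {V : ModuleCat.{0} R → ℤ → Prop} (hV : VanTh V) (c : ℕ) :
    ∀ (M : Type) (g : AddCommGroup M) (m : Module R M), Module.Finite R M → RedCxAux R c M g m →
    ((∃ n₀ : ℤ, ∀ i, n₀ ≤ i → V (ModuleCat.of R M) i) → ∀ i, V (ModuleCat.of R M) i) ∧
    ((∃ n₀ : ℤ, ∀ i, i ≤ n₀ → V (ModuleCat.of R M) i) → ∀ i, V (ModuleCat.of R M) i) := by
  have hpd : ∀ (M : Type) (g : AddCommGroup M) (m : Module R M), Module.Finite R M →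
      HasFinitePd R (ModuleCat.of R M) → ∀ i, V (ModuleCat.of R M) i := by
    intro M g m hfin h
    obtain ⟨n, hn⟩ := pd_of_PdLE _ h
    exact hV.of_pd n _ hfin hn
  induction c with
  | zero =>
    intro M g m hfin h
    exact ⟨fun _ => hpd M g m hfin h, fun _ => hpd M g m hfin h⟩
  | succ c ih =>
    intro M g m hfin h
    rcases h with h | ⟨-, -, j, F, f, -, -, h⟩
    · exact ⟨fun _ => hpd M g m hfin h, fun _ => hpd M g m hfin h⟩
    obtain ⟨ih1, ih2⟩ := ih _ _ _ inferInstance h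
    obtain ⟨a, b, w, hS⟩ := sesK F j f
    refine step j ?_ ?_ ih1 ih2
    · intro i h1 h2
      exact hV.mid hS i h1 ((hV.omega F j i).2 h2)
    · intro hK i
      have e : V (ModuleCat.of R M) i ↔ V (Qm (F.d j)) (i + j) := by
        rw [hV.omega]; simp
      rw [e]
      have e2 : i + ((j + 1 : ℕ) : ℤ) = i + j + 1 := by push_cast; ring
      rw [e2]
      exact ⟨fun h => hV.left hS _ (hK _) h, fun h => hV.right hS _ (hK _) h⟩

end General

section Tate

variable {R : Type} [CommRing R]

/-- `Hom(T,N)` is exact in degree `i`, stated elementarily. -/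
def VT (T : ChainComplex (ModuleCat.{0} R) ℤ) (N : ModuleCat.{0} R) (i : ℤ) : Prop :=
  ∀ a b : ℤ, i + 1 = a → b + 1 = i → ∀ φ : T.X i ⟶ N, T.d a i ≫ φ = 0 →
    ∃ ψ : T.X b ⟶ N, T.d i b ≫ ψ = φ

lemma exactAt_iff_VT (T : ChainComplex (ModuleCat.{0} R) ℤ) (N : ModuleCat.{0} R) (i : ℤ) :
    (T.linearYonedaObj R N).ExactAt i ↔ VT T N i := by
  have key : ∀ a b : ℤ, i + 1 = a → b + 1 = i → ((T.linearYonedaObj R N).ExactAt i ↔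
      ∀ φ : T.X i ⟶ N, T.d a i ≫ φ = 0 → ∃ ψ : T.X b ⟶ N, T.d i b ≫ ψ = φ) := by
    intro a b ha hb
    rw [HomologicalComplex.exactAt_iff' _ b i a
      (by rw [CochainComplex.prev]; omega) (by rw [CochainComplex.next]; omega),
      ShortComplex.moduleCat_exact_iff]
    rfl
  constructor
  · intro h a b ha hb
    exact (key a b ha hb).1 h
  · intro h
    exact (key (i+1) (i-1) rfl (by ring)).2 (h _ _ rfl (by ring))

lemma VT_free (T : ChainComplex (ModuleCat.{0} R) ℤ) (i : ℤ)
    (h : VT T (ModuleCat.of R R) i) (n : ℕ) : VT T (ModuleCat.of R (Fin n → R)) i := by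
  intro a b ha hb φ hφ
  have : ∀ k : Fin n, ∃ ψ : T.X b ⟶ ModuleCat.of R R, T.d i b ≫ ψ =
      φ ≫ ModuleCat.ofHom (LinearMap.proj k) := by
    intro k
    refine h a b ha hb _ ?_
    rw [reassoc_of% hφ, zero_comp]
  choose ψ hψ using this
  refine ⟨ModuleCat.ofHom (LinearMap.pi fun k => (ψ k).hom), ?_⟩
  ext x k
  have := congrArg (fun f => f.hom x) (hψ k)
  exact this

lemma VT_vanTh (T : ChainComplex (ModuleCat.{0} R) ℤ) (hp : ∀ i, Projective (T.X i))
    (hd : ∀ i, VT T (ModuleCat.of R R) i) : VanTh (VT T) where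
  mid := by
    intro S hS i hA hC a b ha hb φ hφ
    have := hS.mono_f
    have := hS.epi_g
    have := hp b
    obtain ⟨ψ, hψ⟩ := hC a b ha hb (φ ≫ S.g) (by rw [reassoc_of% hφ, zero_comp])
    let ψ' := Projective.factorThru ψ S.g
    have hψ' : ψ' ≫ S.g = ψ := Projective.factorThru_comp _ _
    let φA := hS.exact.lift (φ - T.d i b ≫ ψ') (by simp [hψ', hψ])
    have hφA : φA ≫ S.f = φ - T.d i b ≫ ψ' := hS.exact.lift_f _ _
    obtain ⟨χ, hχ⟩ := hA a b ha hb φA (by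
      rw [← cancel_mono S.f]
      simp [hφA, hφ])
    exact ⟨ψ' + χ ≫ S.f, by simp [reassoc_of% hχ, hφA]⟩
  right := by
    intro S hS i hB hA a b ha hb φ hφ
    have := hS.mono_f
    have := hS.epi_g
    have := hp i
    let φ' := Projective.factorThru φ S.g
    have hφ' : φ' ≫ S.g = φ := Projective.factorThru_comp _ _
    subst ha
    let χ := hS.exact.lift (T.d (i+1) i ≫ φ') (by simp [hφ', hφ])
    have hχ : χ ≫ S.f = T.d (i+1) i ≫ φ' := hS.exact.lift_f _ _
    obtain ⟨ψ, hψ⟩ := hA (i+1+1) i rfl rfl χ (by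
      rw [← cancel_mono S.f]
      simp [hχ])
    obtain ⟨ω, hω⟩ := hB (i+1) b rfl hb (φ' - ψ ≫ S.f) (by
      simp [reassoc_of% hψ, hχ])
    exact ⟨ω ≫ S.g, by rw [reassoc_of% hω]; simp [hφ']⟩
  left := by
    intro S hS i hB hC a b ha hb φ hφ
    have := hS.mono_f
    have := hS.epi_g
    have := hp (i-1)
    obtain rfl : b = i := by omega
    obtain ⟨ψ, hψ⟩ := hB a b ha rfl (φ ≫ S.f) (by rw [reassoc_of% hφ, zero_comp])
    obtain ⟨ω, hω⟩ := hC (b+1) (b-1) rfl (by ring) (ψ ≫ S.g) (by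
      rw [reassoc_of% hψ]; simp)
    let ω' := Projective.factorThru ω S.g
    have hω' : ω' ≫ S.g = ω := Projective.factorThru_comp _ _
    let χ := hS.exact.lift (ψ - T.d b (b-1) ≫ ω') (by simp [hω', hω])
    have hχ : χ ≫ S.f = ψ - T.d b (b-1) ≫ ω' := hS.exact.lift_f _ _
    refine ⟨χ, ?_⟩
    rw [← cancel_mono S.f]
    simp [hχ, hψ]
  proj := by
    intro P hP hfin i a b ha hb φ hφ
    obtain ⟨n, π, hπ⟩ := Module.Finite.exists_fin' R P
    let π' : ModuleCat.of R (Fin n → R) ⟶ P := ModuleCat.ofHom π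
    have : Epi π' := (ModuleCat.epi_iff_surjective _).2 hπ
    let s := Projective.factorThru (𝟙 P) π'
    have hs : s ≫ π' = 𝟙 P := Projective.factorThru_comp _ _
    obtain ⟨ψ, hψ⟩ := VT_free T i (hd i) n a b ha hb (φ ≫ s) (by rw [reassoc_of% hφ, zero_comp])
    exact ⟨ψ ≫ π', by rw [reassoc_of% hψ, hs, Category.comp_id]⟩

lemma VT_of_iso_le {T P : ChainComplex (ModuleCat.{0} R) ℤ} (θ : T ⟶ P) (n₀ : ℤ)
    (h : ∀ i, n₀ ≤ i → IsIso (θ.f i)) (L : ModuleCat.{0} R) (i : ℤ) (hi : n₀ + 1 ≤ i) :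
    VT T L i ↔ VT P L i := by
  constructor
  · intro hT a b ha hb φ hφ
    have := h b (by omega)
    have := h i (by omega)
    obtain ⟨ψ, hψ⟩ := hT a b ha hb (θ.f i ≫ φ) (by
      rw [← HomologicalComplex.Hom.comm_assoc, hφ, comp_zero])
    refine ⟨inv (θ.f b) ≫ ψ, ?_⟩
    rw [← cancel_epi (θ.f i), HomologicalComplex.Hom.comm_assoc]
    simp [hψ]
  · intro hP a b ha hb φ hφ
    have := h b (by omega)
    have := h i (by omega)
    have := h a (by omega)
    obtain ⟨ψ, hψ⟩ := hP a b ha hb (inv (θ.f i) ≫ φ) (by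
      rw [← cancel_epi (θ.f a), HomologicalComplex.Hom.comm_assoc]
      simp [hφ])
    refine ⟨θ.f b ≫ ψ, ?_⟩
    rw [← HomologicalComplex.Hom.comm_assoc, hψ]
    simp

/-- Vanishing of `Ext`. -/
def XV (A L : ModuleCat.{0} R) (p : ℕ) : Prop := Subsingleton (Abelian.Ext A L p)

lemma XV_mid {S : ShortComplex (ModuleCat.{0} R)} (hS : S.ShortExact) (L : ModuleCat.{0} R) (p : ℕ)
    (h1 : XV S.X₁ L p) (h3 : XV S.X₃ L p) : XV S.X₂ L p := by
  have := h1
  have := h3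
  refine subsingleton_of_forall_eq 0 fun x => ?_
  obtain ⟨y, rfl⟩ := Abelian.Ext.contravariant_sequence_exact₂ hS L x
    (@Subsingleton.elim _ h1 _ _)
  rw [@Subsingleton.elim _ h3 y 0, Abelian.Ext.comp_zero]

lemma XV_left {S : ShortComplex (ModuleCat.{0} R)} (hS : S.ShortExact) (L : ModuleCat.{0} R) (p : ℕ)
    (h2 : XV S.X₂ L p) (h3 : XV S.X₃ L (p+1)) : XV S.X₁ L p := by
  refine subsingleton_of_forall_eq 0 fun x => ?_
  obtain ⟨y, rfl⟩ := Abelian.Ext.contravariant_sequence_exact₁ hS L x (add_comm 1 p)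
    (@Subsingleton.elim _ h3 _ _)
  rw [@Subsingleton.elim _ h2 y 0, Abelian.Ext.comp_zero]

lemma XV_right {S : ShortComplex (ModuleCat.{0} R)} (hS : S.ShortExact) (L : ModuleCat.{0} R)
    (p : ℕ) (h2 : XV S.X₂ L (p+1)) (h1 : XV S.X₁ L p) : XV S.X₃ L (p+1) := by
  refine subsingleton_of_forall_eq 0 fun x => ?_
  obtain ⟨y, rfl⟩ := Abelian.Ext.contravariant_sequence_exact₃ hS L x
    (@Subsingleton.elim _ h2 _ _) (add_comm 1 p)
  rw [@Subsingleton.elim _ h1 y 0, Abelian.Ext.comp_zero]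

lemma XV_proj (P L : ModuleCat.{0} R) [Projective P] (p : ℕ) : XV P L (p+1) :=
  Abelian.Ext.subsingleton_of_projective ..

lemma XV_iso {A B : ModuleCat.{0} R} (e : A ≅ B) (L : ModuleCat.{0} R) (p : ℕ)
    (h : XV A L (p+1)) : XV B L (p+1) := by
  obtain ⟨w, hS⟩ := ses_of_iso e
  refine XV_right hS L p h ?_
  have hz : IsZero (ModuleCat.of R PUnit.{1}) := ModuleCat.isZero_of_subsingleton _
  have := hz.hasProjectiveDimensionLT_zero
  exact HasProjectiveDimensionLT.subsingleton _ 0 p (Nat.zero_le _) L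

lemma XV_one_iff {S : ShortComplex (ModuleCat.{0} R)} (hS : S.ShortExact) (L : ModuleCat.{0} R)
    (hp : Projective S.X₂) :
    XV S.X₃ L 1 ↔ ∀ φ : S.X₁ ⟶ L, ∃ ψ : S.X₂ ⟶ L, S.f ≫ ψ = φ := by
  constructor
  · intro h φ
    obtain ⟨y, hy⟩ := Abelian.Ext.contravariant_sequence_exact₁ hS L (Abelian.Ext.mk₀ φ)
      (add_zero 1) (@Subsingleton.elim _ h _ _)
    obtain ⟨ψ, rfl⟩ := Abelian.Ext.homEquiv₀.symm.surjective y
    exact ⟨ψ, Abelian.Ext.homEquiv₀.symm.injective (by simpa using hy)⟩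
  · intro h
    refine subsingleton_of_forall_eq 0 fun x => ?_
    obtain ⟨y, rfl⟩ := Abelian.Ext.contravariant_sequence_exact₃ hS L x
      (Abelian.Ext.eq_zero_of_projective _) (add_zero 1)
    obtain ⟨φ, rfl⟩ := Abelian.Ext.homEquiv₀.symm.surjective y
    obtain ⟨ψ, rfl⟩ := h φ
    have : Abelian.Ext.homEquiv₀.symm (S.f ≫ ψ) =
        (Abelian.Ext.mk₀ S.f).comp (Abelian.Ext.mk₀ ψ) (zero_add 0) := by
      simp
    rw [this, hS.extClass_comp_assoc]

lemma chainZ_ker {P : ChainComplex (ModuleCat.{0} R) ℤ} (a i b : ℤ) (ha : i + 1 = a)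
    (hb : b + 1 = i) (h : P.ExactAt i) :
    LinearMap.ker (P.d i b).hom = LinearMap.range (P.d a i).hom := by
  rw [HomologicalComplex.exactAt_iff' _ a i b (by rw [ChainComplex.prev]; omega)
    (by rw [ChainComplex.next]; omega),
    ShortComplex.moduleCat_exact_iff_range_eq_ker] at h
  exact h.symm

lemma VT_iff_XV_one {P : ChainComplex (ModuleCat.{0} R) ℤ} (hp : ∀ i, Projective (P.X i))
    (a i b : ℤ) (ha : i + 1 = a) (hb : b + 1 = i) (h : P.ExactAt i) (L : ModuleCat.{0} R) :
    VT P L i ↔ XV (Qm (P.d i b).hom) L 1 := by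
  obtain ⟨w, hS⟩ := sesQ _ _ (chainZ_ker a i b ha hb h)
  rw [XV_one_iff hS L (hp b)]
  constructor
  · intro hV φ
    obtain ⟨ψ, hψ⟩ := hV a b ha hb
      (ModuleCat.ofHom (LinearMap.range (P.d a i).hom).mkQ ≫ φ) (by
        ext x
        have : (LinearMap.range (P.d a i).hom).mkQ ((P.d a i).hom x) = 0 := by
          simp
        change φ.hom ((LinearMap.range (P.d a i).hom).mkQ ((P.d a i).hom x)) = 0
        rw [this, map_zero])
    refine ⟨ψ, ?_⟩
    ext x
    exact congrArg (fun f => f.hom x) hψ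
  · intro hV a' b' ha' hb' φ hφ
    obtain rfl : a' = a := by omega
    obtain rfl : b' = b := by omega
    have hle : LinearMap.range (P.d a' i).hom ≤ LinearMap.ker φ.hom := by
      rintro _ ⟨x, rfl⟩
      exact congrArg (fun f => f.hom x) hφ
    obtain ⟨ψ, hψ⟩ := hV (ModuleCat.ofHom ((LinearMap.range (P.d a' i).hom).liftQ φ.hom hle))
    refine ⟨ψ, ?_⟩
    ext x
    exact congrArg (fun f => f.hom ((LinearMap.range (P.d a' i).hom).mkQ x)) hψ

lemma XV_shift {M : ModuleCat.{0} R} (C : CompleteResolution R M) (L : ModuleCat.{0} R) (k : ℕ) :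
    ∀ q : ℕ, XV (Qm (C.P.d ((k : ℤ)+1) k).hom) L (q+1) ↔ XV M L (k + q + 1) := by
  induction k with
  | zero =>
    intro q
    have hw := C.exact0
    rw [ShortComplex.moduleCat_exact_iff_range_eq_ker] at hw
    have e : Qm (C.P.d (((0 : ℕ) : ℤ)+1) (0 : ℕ)).hom ≅ M :=
      isoQ (C.P.d 1 0).hom C.π.hom hw.symm ((ModuleCat.epi_iff_surjective _).1 C.epiπ)
    rw [zero_add]
    exact ⟨XV_iso e L q, XV_iso e.symm L q⟩
  | succ k ih =>
    intro q
    have e : k + 1 + q + 1 = k + (q + 1) + 1 := by ring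
    rw [e, ← ih (q+1)]
    obtain ⟨w, hS⟩ := sesQ _ _ (chainZ_ker (((k+1 : ℕ) : ℤ)+1) ((k+1 : ℕ) : ℤ) (k : ℤ) rfl
      (by push_cast; ring) (C.exactP _ (by positivity)))
    have := C.projP k
    exact ⟨fun h => XV_right hS L (q+1) (XV_proj (C.P.X k) L _) h,
      fun h => XV_left hS L (q+1) (XV_proj (C.P.X k) L _) h⟩

lemma VT_iff_XV {M : ModuleCat.{0} R} (C : CompleteResolution R M) :
    ∃ p₀ : ℕ, ∀ p, p₀ ≤ p → ∀ L, VT C.T L p ↔ XV M L p := by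
  obtain ⟨n₀, h⟩ := C.iso_eventually
  refine ⟨n₀.toNat + 1, fun p hp L => ?_⟩
  obtain ⟨k, rfl⟩ : ∃ k, p = k + 1 := ⟨p - 1, by omega⟩
  rw [VT_of_iso_le C.θ n₀ h L _ (by omega), ← XV_shift C L k 0]
  exact VT_iff_XV_one C.projP ((k + 1 : ℕ) + 1) ((k+1 : ℕ) : ℤ) k rfl (by push_cast; ring)
    (C.exactP _ (by positivity)) L

/-- The vanishing pattern in the first variable, using syzygies `Y` of the second. -/
def WV (Y : ℕ → ModuleCat.{0} R) (A : ModuleCat.{0} R) (i : ℤ) : Prop :=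
  ∃ p₀ : ℕ, ∀ p, p₀ ≤ p → ∀ m : ℕ, (m : ℤ) - p = i → XV A (Y m) p

lemma WV_vanTh (Y : ℕ → ModuleCat.{0} R) : VanTh (WV Y) where
  mid := by
    rintro S hS i ⟨p, hp⟩ ⟨q, hq⟩
    exact ⟨max p q, fun r hr m hm => XV_mid hS _ _ (hp r (le_of_max_le_left hr) m hm)
      (hq r (le_of_max_le_right hr) m hm)⟩
  right := by
    rintro S hS i ⟨p, hp⟩ ⟨q, hq⟩
    refine ⟨max p q + 1, fun r hr m hm => ?_⟩
    obtain ⟨r, rfl⟩ : ∃ k, r = k + 1 := ⟨r - 1, by omega⟩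
    exact XV_right hS _ _ (hp _ (by omega) m hm) (hq r (by omega) m (by push_cast at hm; omega))
  left := by
    rintro S hS i ⟨p, hp⟩ ⟨q, hq⟩
    refine ⟨max p q, fun r hr m hm => ?_⟩
    exact XV_left hS _ _ (hp _ (by omega) m hm)
      (hq (r+1) (by omega) m (by push_cast; omega))
  proj := by
    intro P hP _ i
    refine ⟨1, fun r hr m hm => ?_⟩
    obtain ⟨r, rfl⟩ : ∃ k, r = k + 1 := ⟨r - 1, by omega⟩
    exact XV_proj P _ _

lemma exists_syz_seq [IsNoetherianRing R] (N : ModuleCat.{0} R) (hN : Module.Finite R N) :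
    ∃ Y : ℕ → ModuleCat.{0} R, Y 0 = N ∧ ∀ V : ModuleCat.{0} R → ℤ → Prop, VanTh V →
      ∀ m i, V (Y m) i ↔ V (Y (m+1)) (i+1) := by
  have h : ∀ X : {X : ModuleCat.{0} R // Module.Finite R X},
      ∃ Z : {X : ModuleCat.{0} R // Module.Finite R X}, ∀ V : ModuleCat.{0} R → ℤ → Prop,
        VanTh V → ∀ i, V X.1 i ↔ V Z.1 (i+1) := by
    rintro ⟨X, hX⟩
    obtain ⟨Y, F, f, g, w, hY, hF, hFp, hS⟩ := exists_syz X hX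
    refine ⟨⟨Y, hY⟩, fun V hV i => ⟨fun h => ?_, fun h => ?_⟩⟩
    · exact hV.left hS i (hV.proj F hFp hF _) h
    · exact hV.right hS i (hV.proj F hFp hF _) h
  choose nx hnx using h
  refine ⟨fun m => (nx^[m] ⟨N, hN⟩).1, rfl, fun V hV m i => ?_⟩
  simp only [Function.iterate_succ_apply']
  exact hnx _ V hV i

lemma VT_iff_WV {M : ModuleCat.{0} R} (C : CompleteResolution R M) (hV : VanTh (VT C.T))
    (Y : ℕ → ModuleCat.{0} R) (hY : ∀ V : ModuleCat.{0} R → ℤ → Prop, VanTh V →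
      ∀ m i, V (Y m) i ↔ V (Y (m+1)) (i+1)) (i : ℤ) :
    VT C.T (Y 0) i ↔ WV Y M (-i) := by
  obtain ⟨p₀, hp₀⟩ := VT_iff_XV C
  have key : ∀ m : ℕ, VT C.T (Y 0) i ↔ VT C.T (Y m) (i + m) := by
    intro m
    induction m with
    | zero => simp
    | succ m ih =>
      rw [ih, hY _ hV m]
      have : i + m + 1 = i + ((m + 1 : ℕ) : ℤ) := by push_cast; ring
      rw [this]
  constructor
  · intro h
    refine ⟨p₀, fun p hp m hm => ?_⟩
    rw [← hp₀ p hp]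
    have := (key m).1 h
    have e : i + m = p := by omega
    rwa [e] at this
  · rintro ⟨q, hq⟩
    let p : ℕ := max (max p₀ q) i.toNat
    have hpi : i ≤ p := by omega
    rw [key (p - i).toNat]
    have e : i + ((p - i).toNat : ℤ) = p := by omega
    rw [e, hp₀ p (by omega)]
    exact hq p (by omega) _ (by omega)

end Tate

end TateRed

/-- Let `M`, `N` be finitely generated modules over a (Noetherian) local ring `R` with
`G-dim_R M < ∞`, and assume `M` or `N` has reducible complexity. Then the following are
equivalent: (i) `Êxt^i_R(M,N) = 0` for `i ≫ 0`; (ii) `Êxt^i_R(M,N) = 0` for `i ≪ 0`;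
(iii) `Êxt^i_R(M,N) = 0` for all `i ∈ ℤ`. -/
theorem stmt_8 (R : Type) [CommRing R] [IsNoetherianRing R] [IsLocalRing R]
    (M N : Type) [AddCommGroup M] [Module R M] [Module.Finite R M]
    [AddCommGroup N] [Module R N] [Module.Finite R N]
    (hM : HasFiniteGDim R (ModuleCat.of R M))
    (hred : HasReducibleComplexity R M ∨ HasReducibleComplexity R N)
    (C : CompleteResolution R (ModuleCat.of R M)) :
    ((∃ n₀ : ℤ, ∀ i : ℤ, n₀ ≤ i → IsZero (TateExt R C (ModuleCat.of R N) i)) ↔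
      (∃ n₀ : ℤ, ∀ i : ℤ, i ≤ n₀ → IsZero (TateExt R C (ModuleCat.of R N) i))) ∧
    ((∃ n₀ : ℤ, ∀ i : ℤ, i ≤ n₀ → IsZero (TateExt R C (ModuleCat.of R N) i)) ↔
      (∀ i : ℤ, IsZero (TateExt R C (ModuleCat.of R N) i))) := by
  have hT : TateRed.VanTh (TateRed.VT C.T) := TateRed.VT_vanTh C.T C.projT
    (fun i => (TateRed.exactAt_iff_VT _ _ _).1 (C.exactTdual i))
  have hz : ∀ i, IsZero (TateExt R C (ModuleCat.of R N) i) ↔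
      TateRed.VT C.T (ModuleCat.of R N) i := by
    intro i
    rw [← TateRed.exactAt_iff_VT, HomologicalComplex.exactAt_iff_isZero_homology]
    rfl
  simp only [hz]
  suffices h : ((∃ n₀ : ℤ, ∀ i, n₀ ≤ i → TateRed.VT C.T (ModuleCat.of R N) i) →
        ∀ i, TateRed.VT C.T (ModuleCat.of R N) i) ∧
      ((∃ n₀ : ℤ, ∀ i, i ≤ n₀ → TateRed.VT C.T (ModuleCat.of R N) i) →
        ∀ i, TateRed.VT C.T (ModuleCat.of R N) i) by
    exact ⟨⟨fun h1 => ⟨0, fun i _ => h.1 h1 i⟩, fun h2 => ⟨0, fun i _ => h.2 h2 i⟩⟩,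
      ⟨h.2, fun h3 => ⟨0, fun i _ => h3 i⟩⟩⟩
  rcases hred with ⟨c, hc⟩ | ⟨c, hc⟩
  · obtain ⟨Y, hY0, hY⟩ := TateRed.exists_syz_seq (ModuleCat.of R N) ‹Module.Finite R N›
    have key := TateRed.VT_iff_WV C hT Y hY
    rw [hY0] at key
    simp only [key]
    obtain ⟨h1, h2⟩ := (TateRed.WV_vanTh Y).main c M _ _ ‹Module.Finite R M› hc
    constructor
    · rintro ⟨n₀, hn⟩ i
      refine h2 ⟨-n₀, fun i hi => ?_⟩ _
      have := hn (-i) (by omega)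
      rwa [neg_neg] at this
    · rintro ⟨n₀, hn⟩ i
      refine h1 ⟨-n₀, fun i hi => ?_⟩ _
      have := hn (-i) (by omega)
      rwa [neg_neg] at this
  · exact hT.main c N _ _ ‹Module.Finite R N› hc

end
end
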